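/- arXiv:2203.11577 — 2 statements merged into one kernel-verified Lean document; each statement's English description precedes it below -/
import Mathlib

section
/- Let 𝕏 be a countable ω-categorical relational structure which is homogeneous and homomorphism-homogeneous, and suppose the age of 𝕏 (the class of all finite structures embeddable into 𝕏) has the strong amalgamation property with homomorphism gluing. Then End(𝕏), equipped with the pointwise topology, has property X with respect to Aut(𝕏). -/
open Set

variable {A : Type*} {ι : Type*}

/-- `f` is a homomorphism (endomorphism) of the relational structure `(A, rel)`. -/
def IsHom (ar : ι → ℕ) (rel : ∀ i, (Fin (ar i) → A) → Prop) (f : A → A) : Prop :=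
  ∀ (i : ι) (x : Fin (ar i) → A), rel i x → rel i (f ∘ x)

/-- `f` is a self-embedding of the relational structure `(A, rel)`. -/
def IsEmb (ar : ι → ℕ) (rel : ∀ i, (Fin (ar i) → A) → Prop) (f : A → A) : Prop :=
  Function.Injective f ∧ ∀ (i : ι) (x : Fin (ar i) → A), (rel i x ↔ rel i (f ∘ x))

/-- `f` is an automorphism of the relational structure `(A, rel)`. -/
def IsAuto (ar : ι → ℕ) (rel : ∀ i, (Fin (ar i) → A) → Prop) (f : A → A) : Prop :=
  Function.Bijective f ∧ ∀ (i : ι) (x : Fin (ar i) → A), (rel i x ↔ rel i (f ∘ x))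

/-- `p` is an isomorphism between induced substructures when restricted to `D`. -/
def IsPartialIsoOn (ar : ι → ℕ) (rel : ∀ i, (Fin (ar i) → A) → Prop)
    (D : Set A) (p : A → A) : Prop :=
  Set.InjOn p D ∧
    ∀ (i : ι) (x : Fin (ar i) → A), (∀ k, x k ∈ D) → (rel i x ↔ rel i (p ∘ x))

/-- `p` is a homomorphism between induced substructures when restricted to `D`. -/
def IsPartialHomOn (ar : ι → ℕ) (rel : ∀ i, (Fin (ar i) → A) → Prop)
    (D : Set A) (p : A → A) : Prop :=
  ∀ (i : ι) (x : Fin (ar i) → A), (∀ k, x k ∈ D) → rel i x → rel i (p ∘ x)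

/-- Every isomorphism between finite induced substructures extends to an automorphism. -/
def Homogeneous (ar : ι → ℕ) (rel : ∀ i, (Fin (ar i) → A) → Prop) : Prop :=
  ∀ (D : Finset A) (p : A → A), IsPartialIsoOn ar rel ↑D p →
    ∃ g : A → A, IsAuto ar rel g ∧ ∀ a ∈ D, g a = p a

/-- Every orbit on `A \ F` of the pointwise stabiliser of a finite set `F` is infinite. -/
def NoAlgebraicity (ar : ι → ℕ) (rel : ∀ i, (Fin (ar i) → A) → Prop) : Prop :=
  ∀ (F : Finset A) (a : A), a ∉ F →
    {b : A | ∃ g : A → A, IsAuto ar rel g ∧ (∀ x ∈ F, g x = x) ∧ g a = b}.Infinite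

/-- For every `k`, the action of the automorphism group on `k`-tuples has
finitely many orbits. -/
def OmegaCategorical (ar : ι → ℕ) (rel : ∀ i, (Fin (ar i) → A) → Prop) : Prop :=
  ∀ k : ℕ,
    (Set.range fun v : Fin k → A =>
      {w : Fin k → A | ∃ g : A → A, IsAuto ar rel g ∧ w = g ∘ v}).Finite

/-- The endomorphisms of `(A, rel)`, as a set of functions. -/
def endSet (ar : ι → ℕ) (rel : ∀ i, (Fin (ar i) → A) → Prop) : Set (A → A) :=
  {f : A → A | IsHom ar rel f}

/-- The self-embeddings of `(A, rel)`, as a set of functions. -/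
def embSet (ar : ι → ℕ) (rel : ∀ i, (Fin (ar i) → A) → Prop) : Set (A → A) :=
  {f : A → A | IsEmb ar rel f}

/-- The automorphisms of `(A, rel)`, as a set of functions. -/
def autSet (ar : ι → ℕ) (rel : ∀ i, (Fin (ar i) → A) → Prop) : Set (A → A) :=
  {f : A → A | IsAuto ar rel f}

/-- `(A, rel)` is arsfacere, witnessed by the relation symbol `E`. -/
def ArsfacereWith (ar : ι → ℕ) (rel : ∀ i, (Fin (ar i) → A) → Prop) (E : ι) : Prop :=
  (∀ x : A, ¬ rel E (fun _ => x)) ∧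
  ∀ (x : A) (F : Fin (ar E) → Finset A),
    (∀ i j : Fin (ar E), i ≠ j → ((F i : Set A) ∩ (F j : Set A)) = {x}) →
    ∃ f : A → A,
      Set.InjOn f (⋃ i, (F i : Set A)) ∧
      (∀ i, IsPartialIsoOn ar rel (F i : Set A) f) ∧
      ∀ y : Fin (ar E) → A, (∀ k, y k ∈ F k ∧ y k ≠ x) →
        ∃ σ : Equiv.Perm (Fin (ar E)), rel E (fun k => f (y (σ k)))

/-- The topology of pointwise convergence on a set `S` of self-maps of `X`,
where `X` carries the discrete topology. -/
def pointwiseTop (X : Type*) (S : Set (X → X)) : TopologicalSpace ↥S :=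
  TopologicalSpace.generateFrom
    {U : Set ↥S | ∃ x y : X, U = {f : ↥S | f.1 x = y}}

/-- Property **X** of the semigroup (of self-maps, under composition in
diagrammatic order) `S` with respect to the subset `G ⊆ S`, for the topology
`τ` on `S`. -/
def HasPropertyX {X : Type*} (S G : Set (X → X)) (τ : TopologicalSpace ↥S) : Prop :=
  ∀ s : ↥S, ∃ f g t : ↥S, t.1 ∈ G ∧
    s.1 = g.1 ∘ t.1 ∘ f.1 ∧
    ∀ B : Set ↥S, B ∈ @nhds ↥S τ t →
      {u : ↥S | ∃ b : ↥S, b ∈ B ∧ b.1 ∈ G ∧ u.1 = g.1 ∘ b.1 ∘ f.1} ∈ @nhds ↥S τ s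

/-- Every homomorphism between finite induced substructures extends to an
endomorphism. -/
def HomHomogeneous (ar : ι → ℕ) (rel : ∀ i, (Fin (ar i) → A) → Prop) : Prop :=
  ∀ (D : Finset A) (p : A → A), IsPartialHomOn ar rel ↑D p →
    ∃ g : A → A, IsHom ar rel g ∧ ∀ a ∈ D, g a = p a

/-- `e` is an embedding of the induced substructure on `P` into the induced
substructure on `Q`. -/
def IsEmbBetween (ar : ι → ℕ) (rel : ∀ i, (Fin (ar i) → A) → Prop)
    (P Q : Finset A) (e : A → A) : Prop :=
  Set.MapsTo e ↑P ↑Q ∧ Set.InjOn e ↑P ∧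
    ∀ (i : ι) (x : Fin (ar i) → A), (∀ k, x k ∈ P) → (rel i x ↔ rel i (e ∘ x))

/-- The age of `(A, rel)` (realised as the finite induced substructures of the
structure itself) has the strong amalgamation property with homomorphism
gluing. -/
def AgeSAHG (ar : ι → ℕ) (rel : ∀ i, (Fin (ar i) → A) → Prop) : Prop :=
  ∀ (A0 B0 C0 : Finset A) (e₁ e₂ : A → A),
    IsEmbBetween ar rel A0 B0 e₁ → IsEmbBetween ar rel A0 C0 e₂ →
    ∃ (D0 : Finset A) (f₁ f₂ : A → A),
      IsEmbBetween ar rel B0 D0 f₁ ∧ IsEmbBetween ar rel C0 D0 f₂ ∧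
      (∀ a ∈ A0, f₁ (e₁ a) = f₂ (e₂ a)) ∧
      (f₁ '' ↑B0 ∩ f₂ '' ↑C0 = (f₁ ∘ e₁) '' ↑A0) ∧
      ∀ (G : Finset A) (g : A → A), (↑G : Set A) ⊆ ↑D0 →
        (f₁ ∘ e₁) '' ↑A0 ⊆ ↑G →
        IsPartialHomOn ar rel (↑B0 ∩ f₁ ⁻¹' ↑G) (g ∘ f₁) →
        IsPartialHomOn ar rel (↑C0 ∩ f₂ ⁻¹' ↑G) (g ∘ f₂) →
        IsPartialHomOn ar rel ↑G g

section Generic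

open Classical in
/-- A Rasiowa–Sikorski style lemma: a preordered family of approximations `val c` of a function on
finite domains `dom c` has a directed subset which meets countably many prescribed cofinal sets and
has a total limit function. -/
theorem exists_directed_limit [Countable A] {γ κ : Type*} [Countable κ] (r : γ → γ → Prop)
    (hrefl : ∀ c, r c c) (htrans : ∀ c d e, r c d → r d e → r c e) (c₀ : γ)
    (dom : γ → Finset A) (val : γ → A → A)
    (hmono : ∀ c d, r c d → dom c ⊆ dom d ∧ ∀ x ∈ dom c, val d x = val c x)
    (𝒟 : κ → Set γ) (h𝒟 : ∀ j c, ∃ d ∈ 𝒟 j, r c d)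
    (hdom : ∀ (F : Finset A) c, ∃ d, F ⊆ dom d ∧ r c d) :
    ∃ (I : Set γ) (f : A → A), c₀ ∈ I ∧ (∀ c ∈ I, ∀ d ∈ I, ∃ e ∈ I, r c e ∧ r d e) ∧
      (∀ c ∈ I, ∀ x ∈ dom c, f x = val c x) ∧
      (∀ c ∈ I, ∀ F : Finset A, ∃ d ∈ I, r c d ∧ F ⊆ dom d) ∧
      ∀ j, ∃ c ∈ I, c ∈ 𝒟 j := by
  let : Preorder γ := { le := r, le_refl := hrefl, le_trans := htrans }
  let : Encodable (Finset A ⊕ κ) := Encodable.ofCountable _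
  let E : Finset A ⊕ κ → Order.Cofinal γ := Sum.elim
    (fun F => ⟨{c | F ⊆ dom c}, fun c => hdom F c⟩) (fun j => ⟨𝒟 j, fun c => h𝒟 j c⟩)
  let I := Order.idealOfCofinals c₀ E
  have hdir : ∀ c ∈ I, ∀ d ∈ I, ∃ e ∈ I, r c e ∧ r d e := fun c hc d hd => I.directed c hc d hd
  have hmeet : ∀ F : Finset A, ∃ c ∈ I, F ⊆ dom c := by
    intro F
    obtain ⟨c, hc, hcI⟩ := Order.cofinal_meets_idealOfCofinals c₀ E (Sum.inl F)
    exact ⟨c, hcI, hc⟩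
  choose w hwI hw using fun x : A => hmeet {x}
  refine ⟨{c | c ∈ I}, fun x => val (w x) x, Order.mem_idealOfCofinals c₀ E, hdir, ?_, ?_, ?_⟩
  · intro c hc x hx
    obtain ⟨e, -, h₁, h₂⟩ := hdir c hc (w x) (hwI x)
    have hwx : x ∈ dom (w x) := hw x (Finset.mem_singleton_self x)
    change val (w x) x = val c x
    rw [← (hmono _ _ h₁).2 x hx, (hmono _ _ h₂).2 x hwx]
  · intro c hc F
    obtain ⟨d, hd, hF⟩ := hmeet F
    obtain ⟨e, he, h₁, h₂⟩ := hdir c hc d hd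
    exact ⟨e, he, h₁, hF.trans (hmono _ _ h₂).1⟩
  · intro j
    obtain ⟨c, hc, hcI⟩ := Order.cofinal_meets_idealOfCofinals c₀ E (Sum.inr j)
    exact ⟨c, hcI, hc⟩

end Generic

section PointwiseTop

variable {X : Type*} {S : Set (X → X)}

theorem agreement_mem_nhds_pointwiseTop (s : ↥S) (F : Finset X) :
    {u : ↥S | ∀ x ∈ F, u.1 x = s.1 x} ∈ @nhds ↥S (pointwiseTop X S) s := by
  let := pointwiseTop X S
  have h : {u : ↥S | ∀ x ∈ F, u.1 x = s.1 x} = ⋂ x ∈ F, {u : ↥S | u.1 x = s.1 x} := by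
    ext u; simp
  rw [h, Filter.biInter_finset_mem]
  intro x _
  have ho : IsOpen {u : ↥S | u.1 x = s.1 x} :=
    TopologicalSpace.isOpen_generateFrom_of_mem ⟨x, s.1 x, rfl⟩
  exact ho.mem_nhds rfl

open Classical in
theorem exists_agreement_subset_of_mem_nhds_pointwiseTop {s : ↥S} {B : Set ↥S}
    (hB : B ∈ @nhds ↥S (pointwiseTop X S) s) :
    ∃ F : Finset X, {u : ↥S | ∀ x ∈ F, u.1 x = s.1 x} ⊆ B := by
  let := pointwiseTop X S
  obtain ⟨U, hUB, hU, hsU⟩ := mem_nhds_iff.1 hB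
  suffices h : ∃ F : Finset X, {u : ↥S | ∀ x ∈ F, u.1 x = s.1 x} ⊆ U from
    h.imp fun F hF => hF.trans hUB
  clear hUB hB
  have hU' : TopologicalSpace.GenerateOpen
    {U : Set ↥S | ∃ x y : X, U = {f : ↥S | f.1 x = y}} U := hU
  clear hU
  induction hU' with
  | basic V hV =>
    obtain ⟨x, y, rfl⟩ := hV
    refine ⟨{x}, fun u hu => ?_⟩
    exact (hu x (Finset.mem_singleton_self x)).trans hsU
  | univ => exact ⟨∅, Set.subset_univ _⟩
  | inter V W _ _ ihV ihW =>
    obtain ⟨F, hF⟩ := ihV hsU.1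
    obtain ⟨G, hG⟩ := ihW hsU.2
    exact ⟨F ∪ G, fun u hu => ⟨hF fun x hx => hu x (Finset.mem_union_left _ hx),
      hG fun x hx => hu x (Finset.mem_union_right _ hx)⟩⟩
  | sUnion T _ ih =>
    obtain ⟨V, hVT, hsV⟩ := hsU
    obtain ⟨F, hF⟩ := ih V hVT hsV
    exact ⟨F, hF.trans (Set.subset_sUnion_of_mem hVT)⟩

end PointwiseTop

section Structure

variable {ar : ι → ℕ} {rel : ∀ i, (Fin (ar i) → A) → Prop}

theorem IsPartialHomOn.mono {D D' : Set A} {p : A → A} (h : IsPartialHomOn ar rel D p)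
    (hD : D' ⊆ D) : IsPartialHomOn ar rel D' p :=
  fun i x hx => h i x fun k => hD (hx k)

theorem IsPartialHomOn.congr {D : Set A} {p q : A → A} (h : IsPartialHomOn ar rel D p)
    (hpq : ∀ a ∈ D, q a = p a) : IsPartialHomOn ar rel D q := by
  intro i x hx hr
  have : q ∘ x = p ∘ x := funext fun k => hpq _ (hx k)
  rw [this]
  exact h i x hx hr

theorem IsHom.isPartialHomOn {p : A → A} (h : IsHom ar rel p) (D : Set A) :
    IsPartialHomOn ar rel D p :=
  fun i x _ => h i x

theorem IsHom.comp {p q : A → A} (hp : IsHom ar rel p) (hq : IsHom ar rel q) :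
    IsHom ar rel (p ∘ q) :=
  fun i x hx => hp i _ (hq i x hx)

variable (ar rel) in
/-- The automorphism group, as a group of permutations. -/
def autSubgroup : Subgroup (Equiv.Perm A) where
  carrier := {σ | ∀ (i : ι) (x : Fin (ar i) → A), rel i x ↔ rel i (σ ∘ x)}
  mul_mem' {σ τ} hσ hτ i x := (hτ i x).trans (hσ i (τ ∘ x))
  one_mem' _ _ := Iff.rfl
  inv_mem' {σ} hσ i x := by
    have h : σ ∘ (⇑σ⁻¹ ∘ x) = x := by ext; simp
    have := hσ i (⇑σ⁻¹ ∘ x)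
    rw [h] at this
    exact this.symm

theorem isAuto_of_mem_autSubgroup {σ : Equiv.Perm A} (h : σ ∈ autSubgroup ar rel) :
    IsAuto ar rel σ :=
  ⟨σ.bijective, h⟩

theorem isHom_of_mem_autSubgroup {σ : Equiv.Perm A} (h : σ ∈ autSubgroup ar rel) :
    IsHom ar rel σ :=
  fun i x => (h i x).1

theorem Homogeneous.exists_mem_autSubgroup (homog : Homogeneous ar rel) {D : Finset A} {p : A → A}
    (hp : IsPartialIsoOn ar rel ↑D p) : ∃ σ ∈ autSubgroup ar rel, ∀ a ∈ D, σ a = p a := by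
  obtain ⟨g, ⟨hg, hr⟩, h⟩ := homog D p hp
  exact ⟨Equiv.ofBijective g hg, hr, h⟩

/-- Homomorphism gluing inside a homogeneous structure: `C` can be moved over `P` by an automorphism
to a position which is free from `B`. -/
theorem exists_free_position (homog : Homogeneous ar rel) (sahg : AgeSAHG ar rel)
    {P B C : Finset A} (hPB : P ⊆ B) (hPC : P ⊆ C) :
    ∃ e ∈ autSubgroup ar rel, (∀ a ∈ P, e a = a) ∧ (∀ c ∈ C, e c ∈ B → c ∈ P) ∧
      ∀ (G : Set A) (k : A → A), (P : Set A) ⊆ G → G ⊆ ↑B ∪ e '' ↑C →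
        IsPartialHomOn ar rel (↑B ∩ G) k → IsPartialHomOn ar rel (e '' ↑C ∩ G) k →
        IsPartialHomOn ar rel G k := by
  classical
  obtain ⟨D₀, f₁, f₂, ⟨hm₁, hi₁, hr₁⟩, ⟨hm₂, hi₂, hr₂⟩, hcomm, hinter, hglue⟩ :=
    sahg P B C id id ⟨fun a ha => hPB ha, Set.injOn_id _, fun _ _ _ => Iff.rfl⟩
      ⟨fun a ha => hPC ha, Set.injOn_id _, fun _ _ _ => Iff.rfl⟩
  obtain ⟨φ₁, hφ₁, h₁⟩ := homog.exists_mem_autSubgroup ⟨hi₁, hr₁⟩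
  obtain ⟨φ₂, hφ₂, h₂⟩ := homog.exists_mem_autSubgroup ⟨hi₂, hr₂⟩
  have key : ∀ c ∈ C, φ₁ ((φ₁⁻¹ * φ₂) c) = f₂ c := by
    intro c hc
    simp [h₂ c hc]
  refine ⟨φ₁⁻¹ * φ₂, mul_mem (inv_mem hφ₁) hφ₂, ?_, ?_, ?_⟩
  · intro a ha
    apply φ₁.injective
    rw [key a (hPC ha), h₁ a (hPB ha)]
    exact (hcomm a ha).symm
  · intro c hc hcB
    have hmem : f₂ c ∈ f₁ '' ↑B ∩ f₂ '' ↑C :=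
      ⟨⟨_, hcB, by rw [← h₁ _ hcB, key c hc]⟩, ⟨c, hc, rfl⟩⟩
    rw [hinter] at hmem
    obtain ⟨a, ha, hac⟩ := hmem
    have : f₂ a = f₂ c := (hcomm a ha).symm.trans hac
    exact hi₂ (hPC ha) hc this ▸ ha
  · intro G k hPG hG hB hC
    have hGfin : G.Finite := ((B.finite_toSet).union (C.finite_toSet.image _)).subset hG
    have hGcoe : ((hGfin.toFinset.image φ₁ : Finset A) : Set A) = φ₁ '' G := by simp
    have hres := hglue (hGfin.toFinset.image φ₁) (k ∘ ⇑φ₁⁻¹) ?_ ?_ ?_ ?_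
    · intro i x hx hr
      have := hres i (φ₁ ∘ x) (fun j => by rw [hGcoe]; exact ⟨_, hx j, rfl⟩) ((hφ₁ i x).1 hr)
      have he : (k ∘ ⇑φ₁⁻¹) ∘ (φ₁ ∘ x) = k ∘ x := by ext; simp
      rwa [he] at this
    · rw [hGcoe]
      rintro _ ⟨a, ha, rfl⟩
      rcases hG ha with ha | ⟨c, hc, rfl⟩
      · rw [h₁ a ha]; exact hm₁ ha
      · rw [key c hc]; exact hm₂ hc
    · rw [hGcoe]
      rintro _ ⟨a, ha, rfl⟩
      exact ⟨a, hPG ha, h₁ a (hPB ha)⟩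
    · rw [hGcoe]
      refine IsPartialHomOn.congr (p := k) (hB.mono ?_) ?_
      · rintro a ⟨ha, b, hb, hab⟩
        rw [← h₁ a ha] at hab
        exact ⟨ha, φ₁.injective hab ▸ hb⟩
      · rintro a ⟨ha, -⟩
        simp [← h₁ a ha]
    · rw [hGcoe]
      have hC' : IsPartialHomOn ar rel (↑C ∩ f₂ ⁻¹' (φ₁ '' G)) (k ∘ ⇑(φ₁⁻¹ * φ₂)) := by
        intro i x hx hr
        refine hC i (⇑(φ₁⁻¹ * φ₂) ∘ x) (fun j => ⟨⟨_, (hx j).1, rfl⟩, ?_⟩)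
          ((mul_mem (inv_mem hφ₁) hφ₂ : φ₁⁻¹ * φ₂ ∈ autSubgroup ar rel) i x |>.1 hr)
        obtain ⟨b, hb, hab⟩ := (hx j).2
        rw [← key _ (hx j).1] at hab
        change (φ₁⁻¹ * φ₂) (x j) ∈ G
        rwa [← φ₁.injective hab]
      refine hC'.congr ?_
      rintro a ⟨ha, -⟩
      simp [← h₂ a ha]

variable (ar rel) in
/-- The endomorphism `g` realises, up to automorphisms over `P`, every one-point extension of its
restriction to a finite set `P`. -/
def IsUniversalEnd (g : A → A) : Prop :=
  IsHom ar rel g ∧ ∀ (P : Finset A) (a : A), a ∉ P → ∀ h : A → A, IsHom ar rel h →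
    (∀ x ∈ P, h x = g x) → ∃ e ∈ autSubgroup ar rel, (∀ x ∈ P, e x = x) ∧ g (e a) = h a

theorem exists_isUniversalEnd [Countable A] (homog : Homogeneous ar rel)
    (homhom : HomHomogeneous ar rel) (sahg : AgeSAHG ar rel) :
    ∃ g, IsUniversalEnd ar rel g := by
  classical
  let γ := {c : Finset A × (A → A) // IsHom ar rel c.2}
  let r : γ → γ → Prop := fun c d => c.1.1 ⊆ d.1.1 ∧ ∀ x ∈ c.1.1, d.1.2 x = c.1.2 x
  let 𝒟 : (Finset A × A × A) → Set γ := fun j => {c | j.1 ⊆ c.1.1 ∧ (j.2.1 ∉ j.1 →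
    ∀ h : A → A, IsHom ar rel h → (∀ x ∈ j.1, h x = c.1.2 x) → h j.2.1 = j.2.2 →
      ∃ e ∈ autSubgroup ar rel, (∀ x ∈ j.1, e x = x) ∧ e j.2.1 ∈ c.1.1 ∧
        c.1.2 (e j.2.1) = j.2.2)}
  obtain ⟨I, g, h₀, -, hval, hdom, hmeet⟩ := exists_directed_limit r
    (fun c => ⟨subset_rfl, fun _ _ => rfl⟩)
    (fun c d e h₁ h₂ => ⟨h₁.1.trans h₂.1, fun x hx => (h₂.2 x (h₁.1 hx)).trans (h₁.2 x hx)⟩)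
    ⟨(∅, id), fun i x hx => hx⟩ (fun c => c.1.1) (fun c => c.1.2) (fun c d h => h) 𝒟
    (by
      rintro ⟨P, a, c⟩ ⟨⟨D, p⟩, hp⟩
      by_cases H : a ∉ P ∧ ∃ h : A → A, IsHom ar rel h ∧ (∀ x ∈ P, h x = p x) ∧ h a = c
      · obtain ⟨haP, h, hh, hhP, hha⟩ := H
        obtain ⟨e, he, heP, hdisj, hglue⟩ := exists_free_position homog sahg
          (P := P) (B := D ∪ P) (C := insert a P) Finset.subset_union_right
          (Finset.subset_insert a P)
        have hea : e a ∉ D ∪ P := fun hmem => haP (hdisj a (Finset.mem_insert_self a P) hmem)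
        have hupd : ∀ x ∈ D ∪ P, Function.update p (e a) c x = p x := fun x hx =>
          Function.update_of_ne (by rintro rfl; exact hea hx) _ _
        have hk : IsPartialHomOn ar rel ↑(insert (e a) (D ∪ P)) (Function.update p (e a) c) := by
          refine hglue _ _ ?_ ?_ ?_ ?_
          · intro x hx
            simp only [Finset.coe_insert, Finset.coe_union]
            exact Or.inr (Or.inr hx)
          · intro x hx
            rcases Finset.mem_insert.1 (Finset.mem_coe.1 hx) with rfl | hx
            · exact Or.inr ⟨a, by simp, rfl⟩
            · exact Or.inl hx
          · exact (hp.isPartialHomOn _).congr fun x hx => hupd x hx.1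
          · refine ((hh.comp (isHom_of_mem_autSubgroup (inv_mem he))).isPartialHomOn _).congr ?_
            rintro _ ⟨⟨x, hx, rfl⟩, -⟩
            rcases Finset.mem_insert.1 (Finset.mem_coe.1 hx) with rfl | hx
            · simp [hha]
            · rw [heP x hx, hupd x (Finset.mem_union_right _ hx), ← hhP x hx]
              have : e⁻¹ x = x := by rw [Equiv.Perm.inv_eq_iff_eq, heP x hx]
              rw [Function.comp_apply, this]
        obtain ⟨q, hq, hqv⟩ := homhom _ _ hk
        have hqD : ∀ x ∈ D ∪ P, q x = p x := fun x hx =>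
          (hqv x (Finset.mem_insert_of_mem hx)).trans (hupd x hx)
        refine ⟨⟨(insert (e a) (D ∪ P), q), hq⟩, ⟨?_, ?_⟩, ?_, ?_⟩
        · exact fun x hx => Finset.mem_insert_of_mem (Finset.mem_union_right _ hx)
        · intro _ _ _ _ _
          exact ⟨e, he, heP, Finset.mem_insert_self _ _,
            (hqv _ (Finset.mem_insert_self _ _)).trans (Function.update_self _ _ _)⟩
        · exact fun x hx => Finset.mem_insert_of_mem (Finset.mem_union_left _ hx)
        · exact fun x hx => hqD x (Finset.mem_union_left _ hx)
      · exact ⟨⟨(D ∪ P, p), hp⟩, ⟨Finset.subset_union_right,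
          fun ha h h₁ h₂ h₃ => (H ⟨ha, h, h₁, h₂, h₃⟩).elim⟩, Finset.subset_union_left,
          fun _ _ => rfl⟩)
    (fun F c => ⟨⟨(c.1.1 ∪ F, c.1.2), c.2⟩, Finset.subset_union_right, Finset.subset_union_left,
      fun _ _ => rfl⟩)
  refine ⟨g, ?_, ?_⟩
  · intro i x hx
    obtain ⟨c, hc, -, hF⟩ := hdom _ h₀ (Finset.univ.image x)
    have : g ∘ x = c.1.2 ∘ x := funext fun k =>
      hval c hc _ (hF (Finset.mem_image_of_mem x (Finset.mem_univ k)))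
    rw [this]
    exact c.2 i x hx
  · intro P a ha h hh hhg
    obtain ⟨c, hc, hPc, hcD⟩ := hmeet (P, a, h a)
    obtain ⟨e, he, heP, hea, hv⟩ := hcD ha h hh (fun x hx => (hhg x hx).trans (hval c hc x (hPc hx)))
      rfl
    exact ⟨e, he, heP, (hval c hc _ hea).trans hv⟩

open Classical in
theorem IsUniversalEnd.exists_extension {g : A → A} (hg : IsUniversalEnd ar rel g)
    {P : Finset A} {b : Equiv.Perm A} (hb : b ∈ autSubgroup ar rel) {h : A → A}
    (hh : IsHom ar rel h) (hbP : ∀ x ∈ P, g (b x) = h x) (Q : Finset A) :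
    ∃ b' ∈ autSubgroup ar rel, (∀ x ∈ P, b' x = b x) ∧ ∀ x ∈ P ∪ Q, g (b' x) = h x := by
  induction Q using Finset.induction_on with
  | empty => exact ⟨b, hb, fun _ _ => rfl, by simpa using hbP⟩
  | insert a Q _ ih =>
    obtain ⟨b₁, hb₁, hP, hQ⟩ := ih
    by_cases ha : a ∈ P ∪ Q
    · refine ⟨b₁, hb₁, hP, fun x hx => hQ x ?_⟩
      rw [Finset.union_insert, Finset.insert_eq_of_mem ha] at hx
      exact hx
    · obtain ⟨e, he, hfix, hval⟩ := hg.2 ((P ∪ Q).image b₁) (b₁ a)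
        (by simpa using ha) (h ∘ ⇑b₁⁻¹)
        (hh.comp (isHom_of_mem_autSubgroup (inv_mem hb₁))) (by
          intro x hx
          obtain ⟨y, hy, rfl⟩ := Finset.mem_image.1 hx
          simp [hQ y hy])
      have hfix' : ∀ x ∈ P ∪ Q, e (b₁ x) = b₁ x := fun x hx =>
        hfix _ (Finset.mem_image_of_mem b₁ hx)
      refine ⟨e * b₁, mul_mem he hb₁, ?_, ?_⟩
      · intro x hx
        rw [Equiv.Perm.mul_apply, hfix' x (Finset.mem_union_left _ hx), hP x hx]
      · intro x hx
        rw [Finset.union_insert] at hx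
        rcases Finset.mem_insert.1 hx with rfl | hx
        · simpa using hval
        · rw [Equiv.Perm.mul_apply, hfix' x hx, hQ x hx]

variable (ar rel) in
/-- Homomorphisms on `S` and on `T` which come from one function glue to a homomorphism on the
union. -/
def HomGlue (S T : Set A) : Prop :=
  ∀ k : A → A, IsPartialHomOn ar rel S k → IsPartialHomOn ar rel T k →
    IsPartialHomOn ar rel (S ∪ T) k

variable (ar rel) in
/-- The self-embedding `f` sits freely in the structure. -/
structure IsFreeEmb (f : A → A) : Prop where
  isEmb : IsEmb ar rel f
  exists_superset : ∀ F : Finset A, ∃ P : Finset A, F ⊆ P ∧ HomGlue ar rel ↑P (range f)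
  exists_free : ∀ (P : Finset A) (a : A), a ∉ P → HomGlue ar rel ↑P (range f) →
    ∃ e ∈ autSubgroup ar rel, (∀ x ∈ P, e x = x) ∧ e a ∉ range f ∧
      HomGlue ar rel (insert (e a) ↑P) (range f)

variable (ar rel) in
/-- A finite approximation of a free self-embedding: an embedding, represented by an automorphism
`φ`, of a finite domain `D` into a finite part `R` of the codomain. -/
structure FreeApprox where
  D : Finset A
  R : Finset A
  φ : Equiv.Perm A
  mem : φ ∈ autSubgroup ar rel
  mapsTo : ∀ x ∈ D, φ x ∈ R

/-- `d` extends `c` in such a way that the new values are free from the part of the codomain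
already considered by `c`. -/
structure FreeApprox.Extends (c d : FreeApprox ar rel) : Prop where
  D_subset : c.D ⊆ d.D
  R_subset : c.R ⊆ d.R
  eq : ∀ x ∈ c.D, d.φ x = c.φ x
  disj : ∀ x ∈ d.D, d.φ x ∈ c.R → x ∈ c.D
  glue : ∀ S : Set A, c.φ '' ↑c.D ⊆ S → S ⊆ ↑c.R → HomGlue ar rel S (d.φ '' ↑d.D)

theorem FreeApprox.extends_of_eq {c d : FreeApprox ar rel} (hD : d.D = c.D) (hφ : d.φ = c.φ)
    (hR : c.R ⊆ d.R) : c.Extends d where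
  D_subset := hD.symm.subset
  R_subset := hR
  eq x _ := by rw [hφ]
  disj x hx _ := hD ▸ hx
  glue S hS _ k hk _ := by
    rw [hD, hφ, Set.union_eq_self_of_subset_right hS]
    exact hk

theorem FreeApprox.Extends.image_subset {c d : FreeApprox ar rel} (h : c.Extends d) :
    c.φ '' ↑c.D ⊆ d.φ '' ↑d.D := by
  rintro _ ⟨x, hx, rfl⟩
  exact ⟨x, h.D_subset hx, h.eq x hx⟩

theorem FreeApprox.Extends.trans {c d e : FreeApprox ar rel} (h₁ : c.Extends d)
    (h₂ : d.Extends e) : c.Extends e where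
  D_subset := h₁.D_subset.trans h₂.D_subset
  R_subset := h₁.R_subset.trans h₂.R_subset
  eq x hx := (h₂.eq x (h₁.D_subset hx)).trans (h₁.eq x hx)
  disj x hx hxR := by
    have hd := h₂.disj x hx (h₁.R_subset hxR)
    exact h₁.disj x hd (h₂.eq x hd ▸ hxR)
  glue S hS hSR k hk hke := by
    have hd := h₁.glue S hS hSR k hk (hke.mono h₂.image_subset)
    refine (h₂.glue (S ∪ d.φ '' ↑d.D) Set.subset_union_right ?_ k hd hke).mono ?_
    · rintro x (hx | ⟨y, hy, rfl⟩)
      · exact h₁.R_subset (hSR hx)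
      · exact d.mapsTo y hy
    · exact Set.union_subset_union_left _ Set.subset_union_left

theorem FreeApprox.exists_extends (homog : Homogeneous ar rel) (sahg : AgeSAHG ar rel)
    (c : FreeApprox ar rel) (F : Finset A) : ∃ d : FreeApprox ar rel, F ⊆ d.D ∧ c.Extends d := by
  classical
  obtain ⟨e, he, hfix, hdisj, hglue⟩ := exists_free_position homog sahg
    (P := c.D.image c.φ) (B := c.R) (C := (c.D ∪ F).image c.φ)
    (Finset.image_subset_iff.2 c.mapsTo) (Finset.image_subset_image Finset.subset_union_left)
  have himg : ((e * c.φ : Equiv.Perm A) : A → A) '' ↑(c.D ∪ F) =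
      e '' ↑((c.D ∪ F).image c.φ) := by
    rw [Finset.coe_image, Set.image_image]; rfl
  refine ⟨⟨c.D ∪ F, c.R ∪ (c.D ∪ F).image (e * c.φ), e * c.φ, mul_mem he c.mem,
    fun x hx => Finset.mem_union_right _ (Finset.mem_image_of_mem _ hx)⟩,
    Finset.subset_union_right, Finset.subset_union_left, Finset.subset_union_left, ?_, ?_, ?_⟩
  · exact fun x hx => hfix _ (Finset.mem_image_of_mem _ hx)
  · intro x hx hxR
    have := hdisj (c.φ x) (Finset.mem_image_of_mem _ hx) hxR
    simpa using this
  · intro S hS hSR k hk hk'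
    dsimp only at hk' ⊢
    rw [himg] at hk' ⊢
    have hCR : ↑c.R ∩ (e '' ↑((c.D ∪ F).image c.φ)) ⊆ S := by
      rintro _ ⟨hR, y, hy, rfl⟩
      have hyD := hdisj y hy hR
      rw [hfix y hyD]
      exact hS (by simpa only [Finset.coe_image] using Finset.mem_coe.2 hyD)
    refine hglue _ k ?_ (Set.union_subset_union_left _ hSR) (hk.mono ?_)
      (hk'.mono Set.inter_subset_left)
    · exact (by simpa using hS : ((c.D.image c.φ : Finset A) : Set A) ⊆ S).trans
        Set.subset_union_left
    · rintro x ⟨hR, hx | hx⟩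
      · exact hx
      · exact hCR ⟨hR, hx⟩

theorem FreeApprox.exists_extends_free (homog : Homogeneous ar rel) (sahg : AgeSAHG ar rel)
    (c : FreeApprox ar rel) (P : Finset A) (a : A) (ha : a ∉ P) :
    ∃ d : FreeApprox ar rel, (P ⊆ d.R ∧ ∃ e ∈ autSubgroup ar rel, (∀ x ∈ P, e x = x) ∧
      e a ∈ d.R ∧ e a ∉ d.φ '' ↑d.D ∧
      HomGlue ar rel (insert (e a) ↑P) (↑P ∪ d.φ '' ↑d.D)) ∧ c.Extends d := by
  classical
  obtain ⟨e, he, hfix, hdisj, hglue⟩ := exists_free_position homog sahg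
    (P := P) (B := c.R ∪ P) (C := insert a P) Finset.subset_union_right
    (Finset.subset_insert a P)
  have hea : e a ∉ c.R ∪ P := fun h => ha (hdisj a (Finset.mem_insert_self a P) h)
  have himg : e '' ↑(insert a P) = insert (e a) ↑P := by
    rw [Finset.coe_insert, Set.image_insert_eq]
    congr 1
    exact (Set.image_congr fun x hx => hfix x hx).trans (Set.image_id' _)
  have hDR : c.φ '' ↑c.D ⊆ ↑(c.R ∪ P) := by
    rintro _ ⟨x, hx, rfl⟩
    exact Finset.mem_union_left _ (c.mapsTo x hx)
  refine ⟨⟨c.D, insert (e a) (c.R ∪ P), c.φ, c.mem, fun x hx => Finset.mem_insert_of_mem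
    (Finset.mem_union_left _ (c.mapsTo x hx))⟩, ⟨?_, e, he, hfix, Finset.mem_insert_self _ _,
      fun h => hea (hDR h), ?_⟩, FreeApprox.extends_of_eq rfl rfl ?_⟩
  · exact fun x hx => Finset.mem_insert_of_mem (Finset.mem_union_right _ hx)
  · intro k hk hk'
    refine hglue _ k ?_ ?_ (hk'.mono ?_) ?_
    · exact fun x hx => Or.inr (Or.inl hx)
    · rw [himg]
      rintro x (hx | hx | hx)
      · exact Or.inr hx
      · exact Or.inl (Finset.mem_union_right _ hx)
      · exact Or.inl (hDR hx)
    · rintro x ⟨hx, (rfl | hx') | hx'⟩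
      · exact (hea hx).elim
      · exact Or.inl hx'
      · exact hx'
    · rw [himg]
      exact hk.mono Set.inter_subset_left
  · exact fun x hx => Finset.mem_insert_of_mem (Finset.mem_union_left _ hx)

theorem exists_isFreeEmb [Countable A] (homog : Homogeneous ar rel) (sahg : AgeSAHG ar rel) :
    ∃ f, IsFreeEmb ar rel f := by
  classical
  let 𝒟 : Finset A ⊕ {j : Finset A × A // j.2 ∉ j.1} → Set (FreeApprox ar rel) := Sum.elim
    (fun F => {d | F ⊆ d.R})
    (fun j => {d | j.1.1 ⊆ d.R ∧ ∃ e ∈ autSubgroup ar rel, (∀ x ∈ j.1.1, e x = x) ∧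
      e j.1.2 ∈ d.R ∧ e j.1.2 ∉ d.φ '' ↑d.D ∧
      HomGlue ar rel (insert (e j.1.2) ↑j.1.1) (↑j.1.1 ∪ d.φ '' ↑d.D)})
  obtain ⟨I, f, h₀, hdir, hval, hdom, hmeet⟩ := exists_directed_limit FreeApprox.Extends
    (fun c => FreeApprox.extends_of_eq rfl rfl subset_rfl) (fun c d e h₁ h₂ => h₁.trans h₂)
    ⟨∅, ∅, 1, one_mem _, by simp⟩ FreeApprox.D (fun c => c.φ) (fun c d h => ⟨h.D_subset, h.eq⟩) 𝒟
    (by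
      rintro (F | ⟨⟨P, a⟩, ha⟩) c
      · exact ⟨⟨c.D, c.R ∪ F, c.φ, c.mem, fun x hx => Finset.mem_union_left _ (c.mapsTo x hx)⟩,
          Finset.subset_union_right, FreeApprox.extends_of_eq rfl rfl Finset.subset_union_left⟩
      · exact c.exists_extends_free homog sahg P a ha)
    (fun F c => c.exists_extends homog sahg F)
  have himage : ∀ c ∈ I, c.φ '' ↑c.D ⊆ range f := by
    rintro c hc _ ⟨x, hx, rfl⟩
    exact ⟨x, hval c hc x hx⟩
  have hglue : ∀ c ∈ I, ∀ S : Set A, c.φ '' ↑c.D ⊆ S → S ⊆ ↑c.R →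
      HomGlue ar rel S (range f) := by
    intro c hc S hS hSR k hk hkf i x hx hr
    have hpre : ∃ F : Finset A, ∀ j, x j ∈ S ∨ ∃ y ∈ F, f y = x j := by
      have : ∀ j, ∃ y, x j ∈ S ∨ f y = x j := fun j => by
        rcases hx j with h | ⟨y, h⟩
        · exact ⟨x j, Or.inl h⟩
        · exact ⟨y, Or.inr h⟩
      choose y hy using this
      exact ⟨Finset.univ.image y, fun j => (hy j).imp_right fun h =>
        ⟨y j, Finset.mem_image_of_mem y (Finset.mem_univ j), h⟩⟩
    obtain ⟨F, hF⟩ := hpre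
    obtain ⟨d, hd, hcd, hFd⟩ := hdom c hc F
    refine hcd.glue S hS hSR k hk (hkf.mono (himage d hd)) i x (fun j => ?_) hr
    refine (hF j).imp_right ?_
    rintro ⟨y, hy, hyx⟩
    exact ⟨y, hFd hy, by rw [← hyx, hval d hd y (hFd hy)]⟩
  refine ⟨f, ⟨?_, ?_⟩, ?_, ?_⟩
  · intro x y hxy
    obtain ⟨c, hc, -, hF⟩ := hdom _ h₀ {x, y}
    rw [hval c hc x (hF (by simp)), hval c hc y (hF (by simp))] at hxy
    exact c.φ.injective hxy
  · intro i x
    obtain ⟨c, hc, -, hF⟩ := hdom _ h₀ (Finset.univ.image x)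
    have : f ∘ x = c.φ ∘ x := funext fun k =>
      hval c hc _ (hF (Finset.mem_image_of_mem x (Finset.mem_univ k)))
    rw [this]
    exact c.mem i x
  · intro F
    obtain ⟨c, hc, hcF⟩ := hmeet (Sum.inl F)
    refine ⟨c.R, hcF, hglue c hc _ ?_ subset_rfl⟩
    rintro _ ⟨x, hx, rfl⟩
    exact c.mapsTo x hx
  · intro P a ha hP
    obtain ⟨c, hc, hPR, e, he, hfix, heR, hef, heg⟩ := hmeet (Sum.inr ⟨(P, a), ha⟩)
    dsimp only at hPR hfix heR hef heg
    refine ⟨e, he, hfix, ?_, ?_⟩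
    · rintro ⟨x, hx⟩
      obtain ⟨d, hd, hcd, hxd⟩ := hdom c hc {x}
      have hxd : x ∈ d.D := hxd (Finset.mem_singleton_self x)
      rw [hval d hd x hxd] at hx
      have hxc := hcd.disj x hxd (hx ▸ heR)
      exact hef ⟨x, hxc, (hcd.eq x hxc).symm.trans hx⟩
    · intro k hk hkf
      have h₁ := heg k hk ((hP k (hk.mono (Set.subset_insert _ _)) hkf).mono
        (Set.union_subset_union_right _ (himage c hc)))
      refine (hglue c hc _ ?_ ?_ k h₁ hkf).mono
        (Set.union_subset_union_left _ Set.subset_union_left)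
      · exact fun x hx => Or.inr (Or.inr hx)
      · rintro x ((rfl | hx) | hx | ⟨y, hy, rfl⟩)
        · exact heR
        · exact hPR hx
        · exact hPR hx
        · exact c.mapsTo y hy

/-- Back and forth: a finite partial automorphism compatible with `s = g ∘ b ∘ f` extends to an
automorphism `b` satisfying this equation. -/
theorem IsFreeEmb.exists_factorization [Countable A] (homhom : HomHomogeneous ar rel)
    {f g s : A → A} (hf : IsFreeEmb ar rel f) (hg : IsUniversalEnd ar rel g) (hs : IsHom ar rel s)
    {P : Finset A} (hP : HomGlue ar rel ↑P (range f)) {b₀ : Equiv.Perm A}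
    (hb₀ : b₀ ∈ autSubgroup ar rel) (hbP : ∀ x, f x ∈ P → g (b₀ (f x)) = s x) :
    ∃ b : A → A, IsAuto ar rel b ∧ (∀ x ∈ P, b x = b₀ x) ∧ s = g ∘ b ∘ f := by
  classical
  let γ := {c : Finset A × Equiv.Perm A // HomGlue ar rel ↑c.1 (range f) ∧
    c.2 ∈ autSubgroup ar rel ∧ ∀ x, f x ∈ c.1 → g (c.2 (f x)) = s x}
  let r : γ → γ → Prop := fun c d => c.1.1 ⊆ d.1.1 ∧ ∀ x ∈ c.1.1, d.1.2 x = c.1.2 x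
  obtain ⟨I, b, h₀, -, hval, hdom, hmeet⟩ := exists_directed_limit r
    (fun c => ⟨subset_rfl, fun _ _ => rfl⟩)
    (fun c d e h₁ h₂ => ⟨h₁.1.trans h₂.1, fun x hx => (h₂.2 x (h₁.1 hx)).trans (h₁.2 x hx)⟩)
    ⟨(P, b₀), hP, hb₀, hbP⟩ (fun c => c.1.1) (fun c => c.1.2) (fun c d h => h)
    (fun y : A => {c | ∃ x ∈ c.1.1, c.1.2 x = y})
    (by
      rintro y ⟨⟨Q, b⟩, hQ, hb, hbQ⟩
      by_cases hy : b⁻¹ y ∈ Q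
      · exact ⟨⟨(Q, b), hQ, hb, hbQ⟩, ⟨b⁻¹ y, hy, by simp⟩, subset_rfl, fun _ _ => rfl⟩
      · obtain ⟨e, he, hfix, hef, heg⟩ := hf.exists_free Q _ hy hQ
        have hfix' : ∀ x ∈ Q, (b * e⁻¹) x = b x := by
          intro x hx
          have : e⁻¹ x = x := by rw [Equiv.Perm.inv_eq_iff_eq, hfix x hx]
          rw [Equiv.Perm.mul_apply, this]
        refine ⟨⟨(insert (e (b⁻¹ y)) Q, b * e⁻¹), ?_, mul_mem hb (inv_mem he), ?_⟩,
          ⟨e (b⁻¹ y), Finset.mem_insert_self _ _, by simp⟩,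
          Finset.subset_insert _ _, hfix'⟩
        · simpa using heg
        · intro x hx
          rcases Finset.mem_insert.1 hx with hx | hx
          · exact (hef ⟨x, hx⟩).elim
          · exact (congrArg g (hfix' _ hx)).trans (hbQ x hx))
    (by
      rintro F ⟨⟨Q, b⟩, hQ, hb, hbQ⟩
      obtain ⟨R, hFR, hR⟩ := hf.exists_superset (Q ∪ F)
      have hQR : Q ⊆ R := Finset.subset_union_left.trans hFR
      let k : A → A := fun z => if h : ∃ x, f x = z then s h.choose else g (b z)
      have hkf : ∀ x, k (f x) = s x := by
        intro x
        have h : ∃ y, f y = f x := ⟨x, rfl⟩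
        simp only [k, dif_pos h]
        exact congrArg s (hf.isEmb.1 h.choose_spec)
      have hkQ : ∀ z ∈ Q, k z = g (b z) := by
        intro z hz
        by_cases h : ∃ x, f x = z
        · obtain ⟨x, rfl⟩ := h
          rw [hkf, hbQ x hz]
        · simp only [k, dif_neg h]
      have hkrange : IsPartialHomOn ar rel (range f) k := by
        intro i x hx hr
        choose y hy using hx
        obtain rfl : f ∘ y = x := funext hy
        have : k ∘ f ∘ y = s ∘ y := funext fun j => hkf (y j)
        rw [this]
        exact hs i y ((hf.isEmb.2 i y).2 hr)
      have hk : IsPartialHomOn ar rel (↑Q ∪ range f) k :=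
        hQ k (((hg.1.comp (isHom_of_mem_autSubgroup hb)).isPartialHomOn _).congr hkQ) hkrange
      obtain ⟨h, hh, hhk⟩ := homhom (Q ∪ R.filter (· ∈ range f)) k (hk.mono (by
        intro z hz
        simp only [Finset.coe_union, Finset.coe_filter] at hz
        exact hz.imp_right fun hz => hz.2))
      obtain ⟨b', hb', hbb', hgb'⟩ := hg.exists_extension (P := Q) hb hh (fun z hz => by
        rw [hhk z (Finset.mem_union_left _ hz), hkQ z hz]) R
      refine ⟨⟨(R, b'), hR, hb', fun x hx => ?_⟩, Finset.subset_union_right.trans hFR, hQR, hbb'⟩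
      rw [hgb' _ (Finset.mem_union_right _ hx), hhk, hkf]
      exact Finset.mem_union_right _ (Finset.mem_filter.2 ⟨hx, x, rfl⟩))
  refine ⟨b, ⟨⟨?_, ?_⟩, ?_⟩, fun x hx => hval _ h₀ x hx, ?_⟩
  · intro x y hxy
    obtain ⟨c, hc, -, hF⟩ := hdom _ h₀ {x, y}
    rw [hval c hc x (hF (by simp)), hval c hc y (hF (by simp))] at hxy
    exact c.1.2.injective hxy
  · intro y
    obtain ⟨c, hc, x, hx, hxy⟩ := hmeet y
    exact ⟨x, (hval c hc x hx).trans hxy⟩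
  · intro i x
    obtain ⟨c, hc, -, hF⟩ := hdom _ h₀ (Finset.univ.image x)
    have : b ∘ x = c.1.2 ∘ x := funext fun k =>
      hval c hc _ (hF (Finset.mem_image_of_mem x (Finset.mem_univ k)))
    rw [this]
    exact c.2.2.1 i x
  · funext x
    obtain ⟨c, hc, -, hF⟩ := hdom _ h₀ {f x}
    have hx : f x ∈ c.1.1 := hF (Finset.mem_singleton_self _)
    rw [Function.comp_apply, Function.comp_apply, hval c hc _ hx, c.2.2.2 x hx]

end Structure

theorem end_has_propertyX_of_SAHG
    [Countable A]
    (ar : ι → ℕ) (rel : ∀ i, (Fin (ar i) → A) → Prop)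
    (omcat : OmegaCategorical ar rel)
    (homog : Homogeneous ar rel)
    (homhom : HomHomogeneous ar rel)
    (sahg : AgeSAHG ar rel) :
    HasPropertyX (endSet ar rel) (autSet ar rel) (pointwiseTop A (endSet ar rel)) := by
  classical
  obtain ⟨g, hg⟩ := exists_isUniversalEnd homog homhom sahg
  obtain ⟨f, hf⟩ := exists_isFreeEmb homog sahg
  rintro ⟨s, hs⟩
  obtain ⟨t, ht, -, hst⟩ := hf.exists_factorization homhom hg hs (P := ∅)
    (fun k _ hk => by simpa using hk) (one_mem _) (by simp)
  refine ⟨⟨f, fun i x => (hf.isEmb.2 i x).1⟩, ⟨g, hg.1⟩, ⟨t, fun i x => (ht.2 i x).1⟩, ht, hst, ?_⟩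
  intro B hB
  obtain ⟨F, hF⟩ := exists_agreement_subset_of_mem_nhds_pointwiseTop hB
  obtain ⟨P, hFP, hP⟩ := hf.exists_superset F
  refine Filter.mem_of_superset (agreement_mem_nhds_pointwiseTop _
    (P.preimage f hf.isEmb.1.injOn)) ?_
  rintro ⟨u, hu⟩ hus
  have htu : ∀ x, f x ∈ P → g (t (f x)) = u x := fun x hx =>
    (congrFun hst x).symm.trans (hus x (Finset.mem_preimage.2 hx)).symm
  obtain ⟨b, hb, hbt, hub⟩ := hf.exists_factorization homhom hg hu hP
    (b₀ := Equiv.ofBijective t ht.1) ht.2 htu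
  exact ⟨⟨b, fun i x => (hb.2 i x).1⟩, hF fun x hx => hbt x (hFP hx), hb, hub⟩
end

section
/- Let (P, <) be the random strict partial order. Then the pointwise topology on End(P, <) is a Polish semigroup topology, and it is the unique Polish semigroup topology on End(P, <). -/
/-- `τ` is a Polish semigroup topology on the set `S` of self-maps of `X`
(a semigroup under composition in diagrammatic order, `hS` witnessing closure
under composition): `τ` is Polish and composition is continuous. -/
def IsPolishSemigroupTop {X : Type*} {S : Set (X → X)}
    (hS : ∀ f ∈ S, ∀ g ∈ S, g ∘ f ∈ S) (τ : TopologicalSpace ↥S) : Prop :=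
  @PolishSpace ↥S τ ∧
    @Continuous (↥S × ↥S) ↥S (@instTopologicalSpaceProd ↥S ↥S τ τ) τ
      (fun p => ⟨p.2.1 ∘ p.1.1, hS p.1.1 p.1.2 p.2.1 p.2.2⟩)

variable {P : Type*}

/-- The endomorphism monoid of the strict order `(P, lt)`, as a set of
functions. -/
def orderEnd (lt : P → P → Prop) : Set (P → P) :=
  {f : P → P | ∀ x y : P, lt x y → lt (f x) (f y)}

theorem orderEnd_comp (lt : P → P → Prop) :
    ∀ f ∈ orderEnd lt, ∀ g ∈ orderEnd lt, g ∘ f ∈ orderEnd lt :=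
  fun _ hf _ hg x y h => hg _ _ (hf x y h)

/-- `(P, lt)` is homogeneous: every isomorphism between finite induced
suborders extends to an automorphism. -/
def OrderHomogeneous (lt : P → P → Prop) : Prop :=
  ∀ (D : Finset P) (p : P → P),
    Set.InjOn p ↑D →
    (∀ x ∈ D, ∀ y ∈ D, (lt x y ↔ lt (p x) (p y))) →
    ∃ g : P → P, Function.Bijective g ∧ (∀ x y : P, lt x y ↔ lt (g x) (g y)) ∧
      ∀ a ∈ D, g a = p a

/-- Every finite strict partial order embeds into `(P, lt)`. -/
def OrderUniversal (lt : P → P → Prop) : Prop :=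
  ∀ (n : ℕ) (r : Fin n → Fin n → Prop), Irreflexive r → Transitive r →
    ∃ e : Fin n → P, Function.Injective e ∧ ∀ i j, (r i j ↔ lt (e i) (e j))

/-- The one-point extension property characterising the random partial order among countable
partial orders: every finite configuration in which each element of `L` lies below each element of
`U` is realised by a new point whose cut over `D` is generated by `L` and `U`. -/
def OnePointExtension (X : Type*) [PartialOrder X] : Prop :=
  ∀ D L U : Finset X, L ⊆ D → U ⊆ D → (∀ l ∈ L, ∀ u ∈ U, l < u) →
    ∃ z ∉ D, ∀ d ∈ D, (d < z ↔ ∃ l ∈ L, d ≤ l) ∧ (z < d ↔ ∃ u ∈ U, u ≤ d)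

theorem exists_equiv_of_back_and_forth {X Y : Type*} [Countable X] [Countable Y]
    (Good : Finset (X × Y) → Prop) (p₀ : Finset (X × Y)) (h₀ : Good p₀)
    (hinj : ∀ p, Good p → ∀ a ∈ p, ∀ b ∈ p, (a.1 = b.1 ↔ a.2 = b.2))
    (forth : ∀ p, Good p → ∀ x, ∃ q, p ⊆ q ∧ Good q ∧ ∃ y, (x, y) ∈ q)
    (back : ∀ p, Good p → ∀ y, ∃ q, p ⊆ q ∧ Good q ∧ ∃ x, (x, y) ∈ q) :
    ∃ e : X ≃ Y, (∀ a ∈ p₀, e a.1 = a.2) ∧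
      ∀ x x', ∃ p, Good p ∧ (x, e x) ∈ p ∧ (x', e x') ∈ p := by
  classical
  let 𝒟 : X ⊕ Y → Order.Cofinal {p // Good p} := fun i =>
    { carrier := {p | Sum.elim (fun x => ∃ y, (x, y) ∈ p.1) (fun y => ∃ x, (x, y) ∈ p.1) i}
      isCofinal := by
        rintro ⟨p, hp⟩
        rcases i with x | y
        · obtain ⟨q, hpq, hq, h⟩ := forth p hp x
          exact ⟨⟨q, hq⟩, h, hpq⟩
        · obtain ⟨q, hpq, hq, h⟩ := back p hp y
          exact ⟨⟨q, hq⟩, h, hpq⟩ }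
  have : Encodable (X ⊕ Y) := Encodable.ofCountable _
  let I := Order.idealOfCofinals ⟨p₀, h₀⟩ 𝒟
  have hX : ∀ x, ∃ y, ∃ p ∈ I, (x, y) ∈ p.1 := fun x => by
    obtain ⟨p, ⟨y, hy⟩, hp⟩ := Order.cofinal_meets_idealOfCofinals ⟨p₀, h₀⟩ 𝒟 (.inl x)
    exact ⟨y, p, hp, hy⟩
  have hY : ∀ y, ∃ x, ∃ p ∈ I, (x, y) ∈ p.1 := fun y => by
    obtain ⟨p, ⟨x, hx⟩, hp⟩ := Order.cofinal_meets_idealOfCofinals ⟨p₀, h₀⟩ 𝒟 (.inr y)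
    exact ⟨x, p, hp, hx⟩
  have key : ∀ a b : X × Y, (∃ p ∈ I, a ∈ p.1) → (∃ p ∈ I, b ∈ p.1) →
      ∃ p, Good p ∧ a ∈ p ∧ b ∈ p := by
    rintro a b ⟨p, hp, ha⟩ ⟨q, hq, hb⟩
    obtain ⟨r, -, hpr, hqr⟩ := I.directed p hp q hq
    exact ⟨r.1, r.2, hpr ha, hqr hb⟩
  have key' : ∀ a b : X × Y, (∃ p ∈ I, a ∈ p.1) → (∃ p ∈ I, b ∈ p.1) →
      (a.1 = b.1 ↔ a.2 = b.2) := fun a b ha hb => by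
    obtain ⟨r, hr, ha', hb'⟩ := key a b ha hb
    exact hinj r hr a ha' b hb'
  choose f hf using hX
  choose g hg using hY
  refine ⟨⟨f, g, fun x => (key' _ _ (hg (f x)) (hf x)).2 rfl,
    fun y => (key' _ _ (hf (g y)) (hg y)).1 rfl⟩, fun a ha => ?_, fun x x' => key _ _ (hf x) (hf x')⟩
  exact (key' _ _ (hf a.1) ⟨_, Order.mem_idealOfCofinals ⟨p₀, h₀⟩ 𝒟, ha⟩).1 rfl

/-- A finite set of pairs that is the graph of an isomorphism between finite suborders. -/
def IsPartialIso {X Y : Type*} [PartialOrder X] [PartialOrder Y] (p : Finset (X × Y)) : Prop :=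
  ∀ a ∈ p, ∀ b ∈ p, (a.1 ≤ b.1 ↔ a.2 ≤ b.2)

namespace IsPartialIso

variable {X Y : Type*} [PartialOrder X] [PartialOrder Y] {p : Finset (X × Y)}

theorem lt_iff (hp : IsPartialIso p) {a b : X × Y} (ha : a ∈ p) (hb : b ∈ p) :
    a.1 < b.1 ↔ a.2 < b.2 := by
  rw [lt_iff_le_not_ge, lt_iff_le_not_ge, hp a ha b hb, hp b hb a ha]

theorem eq_iff (hp : IsPartialIso p) {a b : X × Y} (ha : a ∈ p) (hb : b ∈ p) :
    a.1 = b.1 ↔ a.2 = b.2 := by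
  rw [le_antisymm_iff, le_antisymm_iff, hp a ha b hb, hp b hb a ha]

open Classical in
theorem insert (hp : IsPartialIso p) {x : X} {z : Y} (hx : ∀ a ∈ p, a.1 ≠ x)
    (hz : ∀ a ∈ p, a.2 ≠ z) (h1 : ∀ a ∈ p, (a.1 < x ↔ a.2 < z))
    (h2 : ∀ a ∈ p, (x < a.1 ↔ z < a.2)) : IsPartialIso (insert (x, z) p) := by
  intro a ha b hb
  rcases Finset.mem_insert.1 ha with rfl | ha <;> rcases Finset.mem_insert.1 hb with rfl | hb
  · simp
  · simpa [le_iff_lt_or_eq, (hx b hb).symm, (hz b hb).symm] using h2 b hb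
  · simpa [le_iff_lt_or_eq, hx a ha, hz a ha] using h1 a ha
  · exact hp a ha b hb

open Classical in
/-- The images in `Y` of the points of the partial isomorphism satisfying `r`. -/
noncomputable def right (p : Finset (X × Y)) (r : X → Prop) : Finset Y :=
  (p.filter fun a => r a.1).image Prod.snd

open Classical in
/-- The preimages in `X` of the points of the partial isomorphism satisfying `r`. -/
noncomputable def left (p : Finset (X × Y)) (r : Y → Prop) : Finset X :=
  (p.filter fun a => r a.2).image Prod.fst

omit [PartialOrder X] [PartialOrder Y] in
theorem mem_right {r : X → Prop} {y : Y} : y ∈ right p r ↔ ∃ a ∈ p, r a.1 ∧ a.2 = y := by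
  simp [right]

omit [PartialOrder X] [PartialOrder Y] in
theorem mem_left {r : Y → Prop} {x : X} : x ∈ left p r ↔ ∃ a ∈ p, r a.2 ∧ a.1 = x := by
  simp [left]

theorem right_lt_right (hp : IsPartialIso p) (x : X) :
    ∀ l ∈ right p (· < x), ∀ u ∈ right p (x < ·), l < u := by
  intro l hl u hu
  obtain ⟨a, ha, hax, rfl⟩ := mem_right.1 hl
  obtain ⟨b, hb, hbx, rfl⟩ := mem_right.1 hu
  exact (hp.lt_iff ha hb).1 (hax.trans hbx)

theorem left_lt_left (hp : IsPartialIso p) (y : Y) :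
    ∀ l ∈ left p (· < y), ∀ u ∈ left p (y < ·), l < u := by
  intro l hl u hu
  obtain ⟨a, ha, hax, rfl⟩ := mem_left.1 hl
  obtain ⟨b, hb, hbx, rfl⟩ := mem_left.1 hu
  exact (hp.lt_iff ha hb).2 (hax.trans hbx)

open Classical in
theorem insert_of_right (hp : IsPartialIso p) {x : X} {z : Y} (hx : ∀ a ∈ p, a.1 ≠ x)
    (hz : z ∉ right p fun _ => True)
    (hcut : ∀ d ∈ right p fun _ => True, (d < z ↔ ∃ l ∈ right p (· < x), d ≤ l) ∧
      (z < d ↔ ∃ u ∈ right p (x < ·), u ≤ d)) : IsPartialIso (Insert.insert (x, z) p) := by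
  have hmem : ∀ a ∈ p, a.2 ∈ right p fun _ => True :=
    fun a ha => mem_right.2 ⟨a, ha, trivial, rfl⟩
  refine hp.insert hx (fun a ha h => hz (h ▸ hmem a ha)) (fun a ha => ?_) (fun a ha => ?_)
  · rw [(hcut _ (hmem a ha)).1]
    refine ⟨fun h => ⟨a.2, mem_right.2 ⟨a, ha, h, rfl⟩, le_rfl⟩, fun ⟨l, hl, hal⟩ => ?_⟩
    obtain ⟨b, hb, hbx, rfl⟩ := mem_right.1 hl
    exact ((hp a ha b hb).2 hal).trans_lt hbx
  · rw [(hcut _ (hmem a ha)).2]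
    refine ⟨fun h => ⟨a.2, mem_right.2 ⟨a, ha, h, rfl⟩, le_rfl⟩, fun ⟨l, hl, hal⟩ => ?_⟩
    obtain ⟨b, hb, hbx, rfl⟩ := mem_right.1 hl
    exact lt_of_lt_of_le hbx ((hp b hb a ha).2 hal)

open Classical in
theorem insert_of_left (hp : IsPartialIso p) {z : X} {y : Y} (hy : ∀ a ∈ p, a.2 ≠ y)
    (hz : z ∉ left p fun _ => True)
    (hcut : ∀ d ∈ left p fun _ => True, (d < z ↔ ∃ l ∈ left p (· < y), d ≤ l) ∧
      (z < d ↔ ∃ u ∈ left p (y < ·), u ≤ d)) : IsPartialIso (Insert.insert (z, y) p) := by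
  have hmem : ∀ a ∈ p, a.1 ∈ left p fun _ => True :=
    fun a ha => mem_left.2 ⟨a, ha, trivial, rfl⟩
  refine hp.insert (fun a ha h => hz (h ▸ hmem a ha)) hy (fun a ha => ?_) (fun a ha => ?_)
  · rw [(hcut _ (hmem a ha)).1]
    refine ⟨fun ⟨l, hl, hal⟩ => ?_, fun h => ⟨a.1, mem_left.2 ⟨a, ha, h, rfl⟩, le_rfl⟩⟩
    obtain ⟨b, hb, hbx, rfl⟩ := mem_left.1 hl
    exact ((hp a ha b hb).1 hal).trans_lt hbx
  · rw [(hcut _ (hmem a ha)).2]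
    refine ⟨fun ⟨l, hl, hal⟩ => ?_, fun h => ⟨a.1, mem_left.2 ⟨a, ha, h, rfl⟩, le_rfl⟩⟩
    obtain ⟨b, hb, hbx, rfl⟩ := mem_left.1 hl
    exact lt_of_lt_of_le hbx ((hp b hb a ha).1 hal)

omit [PartialOrder X] [PartialOrder Y] in
theorem right_subset {r : X → Prop} : right p r ⊆ right p fun _ => True := fun _ hy => by
  obtain ⟨a, ha, -, h⟩ := mem_right.1 hy
  exact mem_right.2 ⟨a, ha, trivial, h⟩

omit [PartialOrder X] [PartialOrder Y] in
theorem left_subset {r : Y → Prop} : left p r ⊆ left p fun _ => True := fun _ hy => by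
  obtain ⟨a, ha, -, h⟩ := mem_left.1 hy
  exact mem_left.2 ⟨a, ha, trivial, h⟩

end IsPartialIso

theorem OnePointExtension.nonempty_orderIso {X Y : Type*} [PartialOrder X] [PartialOrder Y]
    [Countable X] [Countable Y] (hX : OnePointExtension X) (hY : OnePointExtension Y) :
    Nonempty (X ≃o Y) := by
  classical
  obtain ⟨e, -, he⟩ := exists_equiv_of_back_and_forth (X := X) (Y := Y) IsPartialIso ∅
    (by simp [IsPartialIso]) (fun p hp a ha b hb => hp.eq_iff ha hb)
    (fun p hp x => by
      by_cases hx : ∃ y, (x, y) ∈ p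
      · exact ⟨p, subset_rfl, hp, hx⟩
      obtain ⟨z, hz, hcut⟩ := hY _ _ _ IsPartialIso.right_subset IsPartialIso.right_subset
        (hp.right_lt_right x)
      refine ⟨_, Finset.subset_insert _ _, hp.insert_of_right ?_ hz hcut, z,
        Finset.mem_insert_self _ _⟩
      rintro ⟨a, b⟩ ha rfl
      exact hx ⟨b, ha⟩)
    (fun p hp y => by
      by_cases hy : ∃ x, (x, y) ∈ p
      · exact ⟨p, subset_rfl, hp, hy⟩
      obtain ⟨z, hz, hcut⟩ := hX _ _ _ IsPartialIso.left_subset IsPartialIso.left_subset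
        (hp.left_lt_left y)
      refine ⟨_, Finset.subset_insert _ _, hp.insert_of_left ?_ hz hcut, z,
        Finset.mem_insert_self _ _⟩
      rintro ⟨a, b⟩ ha rfl
      exact hy ⟨a, ha⟩)
  refine ⟨⟨e, fun {x x'} => ?_⟩⟩
  obtain ⟨p, hp, h, h'⟩ := he x x'
  exact (hp _ h _ h').symm

namespace GenericExtension

variable {B C : Type*}

/-- A request for a point with prescribed lower generators, upper generators and label. -/
abbrev Request (B C : Type*) := Finset (B ⊕ ℕ) × Finset (B ⊕ ℕ) × C

/-- The label of a point of `B ⊕ ℕ`, the points of `ℕ` answering the requests `e`. -/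
def label (F₀ : B → C) (e : ℕ → Request B C) : B ⊕ ℕ → C
  | .inl b => F₀ b
  | .inr n => (e n).2.2

/-- The points that have been added before stage `n`. -/
def Active (n : ℕ) : B ⊕ ℕ → Prop
  | .inl _ => True
  | .inr m => m < n

theorem Active.mono {n m : ℕ} (h : n ≤ m) {x : B ⊕ ℕ} (hx : Active n x) : Active m x := by
  rcases x with b | k
  · trivial
  · exact lt_of_lt_of_le hx h

theorem not_active_self {n : ℕ} : ¬ Active n (.inr n : B ⊕ ℕ) := lt_irrefl n

theorem active_inl {n : ℕ} {b : B} : Active n (.inl b : B ⊕ ℕ) := trivial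

theorem active_inr_succ {n : ℕ} : Active (n + 1) (.inr n : B ⊕ ℕ) := Nat.lt_succ_self n

theorem exists_active (x : B ⊕ ℕ) : ∃ n, Active n x := by
  rcases x with b | k
  · exact ⟨0, trivial⟩
  · exact ⟨k + 1, Nat.lt_succ_self k⟩

theorem exists_forall_active (D : Finset (B ⊕ ℕ)) : ∃ n, ∀ x ∈ D, Active n x := by
  classical
  induction D using Finset.induction_on with
  | empty => exact ⟨0, by simp⟩
  | insert a s _ ih =>
    obtain ⟨n, hn⟩ := ih
    obtain ⟨m, hm⟩ := exists_active a
    refine ⟨max n m, fun x hx => ?_⟩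
    rcases Finset.mem_insert.1 hx with rfl | hx
    · exact hm.mono (le_max_right _ _)
    · exact (hn x hx).mono (le_max_left _ _)

variable [PartialOrder B] [PartialOrder C]

/-- The request `r` is compatible with the strict order `R` on the points active at stage `n`. -/
structure Valid (F : B ⊕ ℕ → C) (r : Request B C) (n : ℕ) (R : B ⊕ ℕ → B ⊕ ℕ → Prop) :
    Prop where
  active_lower : ∀ l ∈ r.1, Active n l
  active_upper : ∀ u ∈ r.2.1, Active n u
  lt : ∀ l ∈ r.1, ∀ u ∈ r.2.1, R l u
  label_lower : ∀ l ∈ r.1, F l < r.2.2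
  label_upper : ∀ u ∈ r.2.1, r.2.2 < F u

/-- The strict order on the points added before stage `n`. -/
def stage (F : B ⊕ ℕ → C) (e : ℕ → Request B C) : ℕ → B ⊕ ℕ → B ⊕ ℕ → Prop
  | 0 => fun x y => ∃ b b', x = .inl b ∧ y = .inl b' ∧ b < b'
  | n + 1 => fun x y => stage F e n x y ∨ Valid F (e n) n (stage F e n) ∧
      ((y = .inr n ∧ ∃ l ∈ (e n).1, x = l ∨ stage F e n x l) ∨
        (x = .inr n ∧ ∃ u ∈ (e n).2.1, u = y ∨ stage F e n u y))

variable {F₀ : B → C} {e : ℕ → Request B C} {F : B ⊕ ℕ → C}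

theorem stage_active (n : ℕ) : ∀ x y, stage F e n x y → Active n x ∧ Active n y := by
  induction n with
  | zero =>
    rintro x y ⟨b, b', rfl, rfl, -⟩
    exact ⟨trivial, trivial⟩
  | succ n ih =>
    have up : ∀ z : B ⊕ ℕ, Active n z → Active (n + 1) z := fun z => Active.mono n.le_succ
    rintro x y (h | ⟨hv, ⟨rfl, l, hl, h⟩ | ⟨rfl, u, hu, h⟩⟩)
    · exact ⟨up _ (ih x y h).1, up _ (ih x y h).2⟩
    · refine ⟨?_, Nat.lt_succ_self n⟩
      rcases h with rfl | h
      · exact up _ (hv.active_lower _ hl)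
      · exact up _ (ih _ _ h).1
    · refine ⟨Nat.lt_succ_self n, ?_⟩
      rcases h with rfl | h
      · exact up _ (hv.active_upper _ hu)
      · exact up _ (ih _ _ h).2

theorem stage_mono {n m : ℕ} (h : n ≤ m) {x y : B ⊕ ℕ} (hxy : stage F e n x y) :
    stage F e m x y := by
  induction m, h using Nat.le_induction with
  | base => exact hxy
  | succ m _ ih => exact Or.inl ih

theorem stage_succ_iff {n : ℕ} {x y : B ⊕ ℕ} (hx : Active n x) (hy : Active n y) :
    stage F e (n + 1) x y ↔ stage F e n x y := by
  refine ⟨?_, Or.inl⟩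
  rintro (h | ⟨-, ⟨rfl, -⟩ | ⟨rfl, -⟩⟩)
  · exact h
  · exact (not_active_self hy).elim
  · exact (not_active_self hx).elim

theorem stage_iff {n m : ℕ} (h : n ≤ m) {x y : B ⊕ ℕ} (hx : Active n x) (hy : Active n y) :
    stage F e m x y ↔ stage F e n x y := by
  induction m, h using Nat.le_induction with
  | base => rfl
  | succ m hm ih => rw [stage_succ_iff (hx.mono hm) (hy.mono hm), ih]

theorem stage_label (hF₀ : StrictMono F₀) (n : ℕ) :
    ∀ x y, stage (label F₀ e) e n x y → label F₀ e x < label F₀ e y := by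
  induction n with
  | zero =>
    rintro x y ⟨b, b', rfl, rfl, h⟩
    exact hF₀ h
  | succ n ih =>
    rintro x y (h | ⟨hv, ⟨rfl, l, hl, h⟩ | ⟨rfl, u, hu, h⟩⟩)
    · exact ih _ _ h
    · have := hv.label_lower l hl
      rcases h with rfl | h
      · exact this
      · exact (ih _ _ h).trans this
    · have := hv.label_upper u hu
      rcases h with rfl | h
      · exact this
      · exact this.trans (ih _ _ h)

theorem stage_trans (hF₀ : StrictMono F₀) (n : ℕ) : ∀ x y z,
    stage (label F₀ e) e n x y → stage (label F₀ e) e n y z → stage (label F₀ e) e n x z := by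
  induction n with
  | zero =>
    rintro x y z ⟨b, b', rfl, rfl, h⟩ ⟨c, c', hc, rfl, h'⟩
    obtain rfl := Sum.inl_injective hc
    exact ⟨b, c', rfl, rfl, h.trans h'⟩
  | succ n ih =>
    have act := stage_active (F := label F₀ e) (e := e) n
    rintro x y z (h | ⟨hv, ⟨rfl, l, hl, h⟩ | ⟨rfl, u, hu, h⟩⟩)
      (h' | ⟨hv', ⟨hy', l', hl', h'⟩ | ⟨hy', u', hu', h'⟩⟩)
    · exact Or.inl (ih _ _ _ h h')
    · refine Or.inr ⟨hv', Or.inl ⟨hy', l', hl', Or.inr ?_⟩⟩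
      rcases h' with rfl | h'
      · exact h
      · exact ih _ _ _ h h'
    · exact (not_active_self (hy' ▸ (act _ _ h).2)).elim
    · exact (not_active_self (act _ _ h').1).elim
    · exfalso
      rcases h' with rfl | h'
      · exact not_active_self (hv.active_lower _ hl')
      · exact not_active_self (act _ _ h').1
    · have := hv.lt l hl u' hu'
      refine Or.inl ?_
      rcases h with rfl | h <;> rcases h' with rfl | h'
      · exact this
      · exact ih _ _ _ this h'
      · exact ih _ _ _ h this
      · exact ih _ _ _ h (ih _ _ _ this h')
    · refine Or.inr ⟨hv, Or.inr ⟨rfl, u, hu, Or.inr ?_⟩⟩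
      rcases h with rfl | h
      · exact h'
      · exact ih _ _ _ h h'
    · subst hy'
      exfalso
      have lab := stage_label (e := e) hF₀ n
      have hlu := lab _ _ (hv.lt l' hl' u hu)
      rcases h with rfl | h <;> rcases h' with rfl | h'
      · exact lt_irrefl _ hlu
      · exact lt_asymm hlu (lab _ _ h')
      · exact lt_asymm hlu (lab _ _ h)
      · exact lt_asymm hlu ((lab _ _ h).trans (lab _ _ h'))
    · exfalso
      subst hy'
      rcases h with rfl | h
      · exact not_active_self (hv.active_upper _ hu)
      · exact not_active_self (act _ _ h).2

/-- The limit of the stages. -/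
def rel (F : B ⊕ ℕ → C) (e : ℕ → Request B C) (x y : B ⊕ ℕ) : Prop := ∃ n, stage F e n x y

theorem rel_iff {n : ℕ} {x y : B ⊕ ℕ} (hx : Active n x) (hy : Active n y) :
    rel F e x y ↔ stage F e n x y := by
  refine ⟨?_, fun h => ⟨n, h⟩⟩
  rintro ⟨m, h⟩
  exact (stage_iff (le_max_left n m) hx hy).1 (stage_mono (le_max_right n m) h)

theorem rel_inl_inl {b b' : B} : rel F e (.inl b) (.inl b') ↔ b < b' := by
  rw [rel_iff (n := 0) active_inl active_inl]
  constructor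
  · rintro ⟨c, c', h, h', hlt⟩
    rwa [Sum.inl_injective h, Sum.inl_injective h']
  · exact fun h => ⟨b, b', rfl, rfl, h⟩

theorem rel_label (hF₀ : StrictMono F₀) {x y : B ⊕ ℕ} (h : rel (label F₀ e) e x y) :
    label F₀ e x < label F₀ e y := by
  obtain ⟨n, h⟩ := h
  exact stage_label hF₀ n x y h

theorem rel_trans (hF₀ : StrictMono F₀) {x y z : B ⊕ ℕ} (h : rel (label F₀ e) e x y)
    (h' : rel (label F₀ e) e y z) : rel (label F₀ e) e x z := by
  obtain ⟨n, h⟩ := h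
  obtain ⟨m, h'⟩ := h'
  exact ⟨max n m, stage_trans hF₀ _ x y z (stage_mono (le_max_left n m) h)
    (stage_mono (le_max_right n m) h')⟩

theorem rel_inr_iff {n : ℕ} {x : B ⊕ ℕ} (hx : Active n x) :
    rel F e x (.inr n) ↔ Valid F (e n) n (stage F e n) ∧ ∃ l ∈ (e n).1, x = l ∨ rel F e x l := by
  rw [rel_iff (n := n + 1) (hx.mono n.le_succ) active_inr_succ]
  constructor
  · rintro (h | ⟨hv, ⟨-, l, hl, h⟩ | ⟨rfl, -⟩⟩)
    · exact (not_active_self (stage_active _ _ _ h).2).elim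
    · exact ⟨hv, l, hl, h.imp_right fun h => ⟨n, h⟩⟩
    · exact (not_active_self hx).elim
  · rintro ⟨hv, l, hl, h⟩
    exact Or.inr ⟨hv, Or.inl ⟨rfl, l, hl, h.imp_right (rel_iff hx (hv.active_lower l hl)).1⟩⟩

theorem inr_rel_iff {n : ℕ} {x : B ⊕ ℕ} (hx : Active n x) :
    rel F e (.inr n) x ↔
      Valid F (e n) n (stage F e n) ∧ ∃ u ∈ (e n).2.1, u = x ∨ rel F e u x := by
  rw [rel_iff (n := n + 1) active_inr_succ (hx.mono n.le_succ)]
  constructor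
  · rintro (h | ⟨hv, ⟨rfl, -⟩ | ⟨-, u, hu, h⟩⟩)
    · exact (not_active_self (stage_active _ _ _ h).1).elim
    · exact (not_active_self hx).elim
    · exact ⟨hv, u, hu, h.imp_right fun h => ⟨n, h⟩⟩
  · rintro ⟨hv, u, hu, h⟩
    exact Or.inr ⟨hv, Or.inr ⟨rfl, u, hu, h.imp_right (rel_iff (hv.active_upper u hu) hx).1⟩⟩

theorem exists_upper_generators (n : ℕ) : ∀ z : B ⊕ ℕ, Active n z →
    ∃ S : Finset B, ∀ b, (z = .inl b ∨ rel F e z (.inl b)) →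
      ∃ c ∈ S, (z = .inl c ∨ rel F e z (.inl c)) ∧ c ≤ b := by
  classical
  induction n using Nat.strong_induction_on with
  | _ n ih =>
  rintro (b₀ | m) hz
  · refine ⟨{b₀}, fun b hb => ⟨b₀, Finset.mem_singleton_self _, Or.inl rfl, ?_⟩⟩
    rcases hb with hb | hb
    · exact (Sum.inl_injective hb).le
    · exact (rel_inl_inl.1 hb).le
  · have hS : ∀ u : B ⊕ ℕ, ∃ S : Finset B, Active m u →
        ∀ b, (u = .inl b ∨ rel F e u (.inl b)) →
          ∃ c ∈ S, (u = .inl c ∨ rel F e u (.inl c)) ∧ c ≤ b := fun u => by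
      by_cases hu : Active m u
      · obtain ⟨S, h⟩ := ih m hz u hu
        exact ⟨S, fun _ => h⟩
      · exact ⟨∅, fun h => (hu h).elim⟩
    choose S hS using hS
    refine ⟨(e m).2.1.biUnion S, fun b hb => ?_⟩
    have hb := hb.resolve_left (by simp)
    obtain ⟨hv, u, hu, h⟩ := (inr_rel_iff active_inl).1 hb
    obtain ⟨c, hc, h', hcb⟩ := hS u (hv.active_upper u hu) b h
    exact ⟨c, Finset.mem_biUnion.2 ⟨u, hu, hc⟩,
      Or.inr ((inr_rel_iff active_inl).2 ⟨hv, u, hu, h'⟩), hcb⟩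

theorem exists_lower_generators (n : ℕ) : ∀ z : B ⊕ ℕ, Active n z →
    ∃ S : Finset B, ∀ b, (.inl b = z ∨ rel F e (.inl b) z) →
      ∃ c ∈ S, (.inl c = z ∨ rel F e (.inl c) z) ∧ b ≤ c := by
  classical
  induction n using Nat.strong_induction_on with
  | _ n ih =>
  rintro (b₀ | m) hz
  · refine ⟨{b₀}, fun b hb => ⟨b₀, Finset.mem_singleton_self _, Or.inl rfl, ?_⟩⟩
    rcases hb with hb | hb
    · exact (Sum.inl_injective hb).le
    · exact (rel_inl_inl.1 hb).le
  · have hS : ∀ u : B ⊕ ℕ, ∃ S : Finset B, Active m u →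
        ∀ b, (.inl b = u ∨ rel F e (.inl b) u) →
          ∃ c ∈ S, (.inl c = u ∨ rel F e (.inl c) u) ∧ b ≤ c := fun u => by
      by_cases hu : Active m u
      · obtain ⟨S, h⟩ := ih m hz u hu
        exact ⟨S, fun _ => h⟩
      · exact ⟨∅, fun h => (hu h).elim⟩
    choose S hS using hS
    refine ⟨(e m).1.biUnion S, fun b hb => ?_⟩
    have hb := hb.resolve_left (by simp)
    obtain ⟨hv, u, hu, h⟩ := (rel_inr_iff active_inl).1 hb
    obtain ⟨c, hc, h', hcb⟩ := hS u (hv.active_lower u hu) b h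
    exact ⟨c, Finset.mem_biUnion.2 ⟨u, hu, hc⟩,
      Or.inr ((rel_inr_iff active_inl).2 ⟨hv, u, hu, h'⟩), hcb⟩

theorem exists_realization (he : ∀ r n, ∃ m ≥ n, e m = r)
    (D L U : Finset (B ⊕ ℕ)) (q : C) (hLU : ∀ l ∈ L, ∀ u ∈ U, rel F e l u)
    (hL : ∀ l ∈ L, F l < q) (hU : ∀ u ∈ U, q < F u) :
    ∃ n, e n = (L, U, q) ∧ (∀ x ∈ D, Active n x) ∧ ∀ x, Active n x →
      (rel F e x (.inr n) ↔ ∃ l ∈ L, x = l ∨ rel F e x l) ∧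
      (rel F e (.inr n) x ↔ ∃ u ∈ U, u = x ∨ rel F e u x) := by
  classical
  obtain ⟨k, hk⟩ := exists_forall_active (D ∪ L ∪ U)
  obtain ⟨n, hkn, hn⟩ := he (L, U, q) k
  have hact : ∀ x ∈ D ∪ L ∪ U, Active n x := fun x hx => (hk x hx).mono hkn
  have hv : Valid F (e n) n (stage F e n) := by
    rw [hn]
    have h1 : ∀ l ∈ L, Active n l := fun l hl => hact l (by simp [hl])
    have h2 : ∀ u ∈ U, Active n u := fun u hu => hact u (by simp [hu])
    exact ⟨h1, h2, fun l hl u hu => (rel_iff (h1 l hl) (h2 u hu)).1 (hLU l hl u hu), hL, hU⟩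
  refine ⟨n, hn, fun x hx => hact x (by simp [hx]), fun x hx => ⟨?_, ?_⟩⟩
  · rw [rel_inr_iff hx, hn] at *
    simp only [hn ▸ hv, true_and]
  · rw [inr_rel_iff hx, hn] at *
    simp only [hn ▸ hv, true_and]

end GenericExtension

universe u in
open GenericExtension in
/-- Every strictly monotone map `F₀ : B → C` between countable partial orders extends to a map `F`
on a generic countable extension `Q` of `B` in which every cut over `B` is finitely generated. -/
theorem exists_generic_extension {B : Type u} {C : Type*} [PartialOrder B]
    [PartialOrder C] [Countable B] [Countable C] [Nonempty C] (F₀ : B → C) (hF₀ : StrictMono F₀) :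
    ∃ (Q : Type u) (_ : PartialOrder Q) (_ : Countable Q) (g : B ↪o Q) (F : Q → C),
      StrictMono F ∧ (∀ b, F (g b) = F₀ b) ∧
      (∀ z, ∃ S : Finset B, ∀ b, z ≤ g b → ∃ c ∈ S, z ≤ g c ∧ c ≤ b) ∧
      (∀ z, ∃ S : Finset B, ∀ b, g b ≤ z → ∃ c ∈ S, g c ≤ z ∧ b ≤ c) ∧
      ∀ (D L U : Finset Q) (q : C), (∀ l ∈ L, ∀ u ∈ U, l < u) → (∀ l ∈ L, F l < q) →
        (∀ u ∈ U, q < F u) → ∃ z ∉ D, z ∉ Set.range g ∧ F z = q ∧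
          ∀ x, x ∈ D ∨ x ∈ Set.range g →
            (x < z ↔ ∃ l ∈ L, x ≤ l) ∧ (z < x ↔ ∃ u ∈ U, u ≤ x) := by
  classical
  obtain ⟨e₀, he₀⟩ := exists_surjective_nat (Request B C)
  let e : ℕ → Request B C := fun n => e₀ n.unpair.1
  have he : ∀ r n, ∃ m ≥ n, e m = r := fun r n => by
    obtain ⟨k, rfl⟩ := he₀ r
    exact ⟨Nat.pair k n, Nat.right_le_pair k n, by simp [e]⟩
  let R := rel (label F₀ e) e
  have hirr : ∀ x, ¬ R x x := fun x h => lt_irrefl _ (rel_label hF₀ h)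
  let po : PartialOrder (B ⊕ ℕ) :=
    { le := fun x y => x = y ∨ R x y
      lt := R
      le_refl := fun x => Or.inl rfl
      le_trans := by
        rintro x y z (rfl | h) (rfl | h')
        · exact Or.inl rfl
        · exact Or.inr h'
        · exact Or.inr h
        · exact Or.inr (rel_trans hF₀ h h')
      le_antisymm := by
        rintro x y (rfl | h) (h' | h')
        · rfl
        · rfl
        · exact h'.symm
        · exact (hirr _ (rel_trans hF₀ h h')).elim
      lt_iff_le_not_ge := by
        intro x y
        constructor
        · intro h
          refine ⟨Or.inr h, ?_⟩
          rintro (rfl | h')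
          · exact hirr _ h
          · exact hirr _ (rel_trans hF₀ h h')
        · rintro ⟨rfl | h, h'⟩
          · exact (h' (Or.inl rfl)).elim
          · exact h }
  have hlt : ∀ x y, po.lt x y ↔ rel (label F₀ e) e x y := fun _ _ => Iff.rfl
  have hle : ∀ x y, po.le x y ↔ x = y ∨ rel (label F₀ e) e x y := fun _ _ => Iff.rfl
  refine ⟨B ⊕ ℕ, po, inferInstance, ⟨⟨Sum.inl, Sum.inl_injective⟩, fun {a b} => ?_⟩,
    label F₀ e, fun x y h => rel_label hF₀ h, fun b => rfl, fun z => ?_, fun z => ?_, ?_⟩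
  · refine (hle _ _).trans ?_
    rw [Function.Embedding.coeFn_mk, rel_inl_inl, Sum.inl_injective.eq_iff, le_iff_eq_or_lt]
  · obtain ⟨n, hn⟩ := exists_active z
    exact exists_upper_generators n z hn
  · obtain ⟨n, hn⟩ := exists_active z
    exact exists_lower_generators n z hn
  · intro D L U q hLU hL hU
    obtain ⟨n, hn, hD, hx⟩ := exists_realization he D L U q hLU hL hU
    refine ⟨.inr n, fun h => not_active_self (hD _ h), ?_, ?_, ?_⟩
    · rintro ⟨b, hb⟩
      cases hb
    · change (e n).2.2 = q
      rw [hn]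
    · rintro x (h | ⟨b, rfl⟩)
      · exact hx x (hD x h)
      · exact hx _ active_inl

/-- Any two finite sets, one strictly below the other, have an element strictly in between. -/
def FiniteInterpolation (X : Type*) [PartialOrder X] : Prop :=
  ∀ L U : Finset X, (∀ l ∈ L, ∀ u ∈ U, l < u) → ∃ q, (∀ l ∈ L, l < q) ∧ ∀ u ∈ U, q < u

theorem FiniteInterpolation.nonempty {X : Type*} [PartialOrder X] (h : FiniteInterpolation X) :
    Nonempty X :=
  let ⟨q, _⟩ := h ∅ ∅ (by simp)
  ⟨q⟩

theorem finiteInterpolation_rat : FiniteInterpolation ℚ := fun L U h => by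
  obtain ⟨q, h1, h2⟩ := Order.exists_between_finsets L U h
  exact ⟨q, h1, h2⟩

theorem OnePointExtension.finiteInterpolation {X : Type*} [PartialOrder X]
    (hX : OnePointExtension X) : FiniteInterpolation X := fun L U h => by
  classical
  obtain ⟨z, -, hz⟩ := hX (L ∪ U) L U Finset.subset_union_left Finset.subset_union_right h
  exact ⟨z, fun l hl => (hz l (Finset.mem_union_left _ hl)).1.2 ⟨l, hl, le_rfl⟩,
    fun u hu => (hz u (Finset.mem_union_right _ hu)).2.2 ⟨u, hu, le_rfl⟩⟩

theorem exists_generic_orderIso {X B C : Type*} [PartialOrder X] [Countable X]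
    (hX : OnePointExtension X) [PartialOrder B] [PartialOrder C] [Countable B] [Countable C]
    (hC : FiniteInterpolation C) (F₀ : B → C) (hF₀ : StrictMono F₀) :
    ∃ (g : B ↪o X) (F : X → C), StrictMono F ∧
      (∀ z, ∃ S : Finset B, ∀ b, z ≤ g b → ∃ c ∈ S, z ≤ g c ∧ c ≤ b) ∧
      (∀ z, ∃ S : Finset B, ∀ b, g b ≤ z → ∃ c ∈ S, g c ≤ z ∧ b ≤ c) ∧
      ∀ (D L U : Finset X) (q : C), (∀ l ∈ L, ∀ u ∈ U, l < u) → (∀ l ∈ L, F l < q) →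
        (∀ u ∈ U, q < F u) → ∃ z ∉ D, z ∉ Set.range g ∧ F z = q ∧
          ∀ x, x ∈ D ∨ x ∈ Set.range g →
            (x < z ↔ ∃ l ∈ L, x ≤ l) ∧ (z < x ↔ ∃ u ∈ U, u ≤ x) := by
  classical
  have := hC.nonempty
  obtain ⟨Q, _, _, g, F, hF, -, hup, hlow, hreal⟩ := exists_generic_extension F₀ hF₀
  have hQ : OnePointExtension Q := fun D L U _ _ hLU => by
    obtain ⟨q, h1, h2⟩ := hC (L.image F) (U.image F) (by
      simp only [Finset.forall_mem_image]
      exact fun l hl u hu => hF (hLU l hl u hu))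
    simp only [Finset.forall_mem_image] at h1 h2
    obtain ⟨z, hz, -, -, h⟩ := hreal D L U q hLU (fun l hl => h1 hl) (fun u hu => h2 hu)
    exact ⟨z, hz, fun d hd => h d (Or.inl hd)⟩
  obtain ⟨θ⟩ := hQ.nonempty_orderIso hX
  refine ⟨g.trans θ.toOrderEmbedding, F ∘ θ.symm, hF.comp θ.symm.strictMono, fun z => ?_,
    fun z => ?_, ?_⟩
  · obtain ⟨S, hS⟩ := hup (θ.symm z)
    refine ⟨S, fun b hb => ?_⟩
    obtain ⟨c, hc, hzc, hcb⟩ := hS b (θ.symm_apply_le.2 hb)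
    exact ⟨c, hc, θ.symm_apply_le.1 hzc, hcb⟩
  · obtain ⟨S, hS⟩ := hlow (θ.symm z)
    refine ⟨S, fun b hb => ?_⟩
    obtain ⟨c, hc, hzc, hcb⟩ := hS b (θ.le_symm_apply.2 hb)
    exact ⟨c, hc, θ.le_symm_apply.1 hzc, hcb⟩
  · intro D L U q hLU hL hU
    obtain ⟨z, hzD, hzg, hzq, hz⟩ := hreal (D.image θ.symm) (L.image θ.symm) (U.image θ.symm) q
      (by simpa only [Finset.forall_mem_image, θ.symm.lt_iff_lt] using hLU)
      (Finset.forall_mem_image.2 fun l hl => hL l hl)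
      (Finset.forall_mem_image.2 fun u hu => hU u hu)
    refine ⟨θ z, fun h => hzD (Finset.mem_image.2 ⟨_, h, by simp⟩), ?_, by simpa using hzq, ?_⟩
    · rintro ⟨b, hb⟩
      exact hzg ⟨b, θ.injective hb⟩
    · intro x hx
      have := hz (θ.symm x) (by
        rcases hx with hx | ⟨b, rfl⟩
        · exact Or.inl (Finset.mem_image_of_mem _ hx)
        · exact Or.inr ⟨b, by simp⟩)
      simp only [Finset.exists_mem_image, θ.symm.le_iff_le] at this
      rw [← this.1, ← this.2, θ.symm_apply_lt, θ.lt_symm_apply]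
      exact ⟨Iff.rfl, Iff.rfl⟩

/-- The pair consisting of a generic endomorphism `f` and a self-embedding `g` with finitely
generated cuts, such that points of arbitrary `f`-value can be realised generically over `g`. -/
structure IsGenericPair {X : Type*} [PartialOrder X] (f : X → X) (g : X ↪o X) : Prop where
  strictMono : StrictMono f
  upper : ∀ z, ∃ S : Finset X, ∀ b, z ≤ g b → ∃ c ∈ S, z ≤ g c ∧ c ≤ b
  lower : ∀ z, ∃ S : Finset X, ∀ b, g b ≤ z → ∃ c ∈ S, g c ≤ z ∧ b ≤ c
  realize : ∀ (D L U : Finset X) (q : X), (∀ l ∈ L, ∀ u ∈ U, l < u) → (∀ l ∈ L, f l < q) →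
    (∀ u ∈ U, q < f u) → ∃ z ∉ D, z ∉ Set.range g ∧ f z = q ∧
      ∀ x, x ∈ D ∨ x ∈ Set.range g →
        (x < z ↔ ∃ l ∈ L, x ≤ l) ∧ (z < x ↔ ∃ u ∈ U, u ≤ x)

theorem OnePointExtension.exists_isGenericPair {X : Type*} [PartialOrder X] [Countable X]
    (hX : OnePointExtension X) : ∃ (f : X → X) (g : X ↪o X), IsGenericPair f g := by
  obtain ⟨g, f, hf, hup, hlow, hreal⟩ :=
    exists_generic_orderIso hX hX.finiteInterpolation (id : X → X) strictMono_id
  exact ⟨f, g, hf, hup, hlow, hreal⟩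

namespace IsGenericPair

variable {X : Type*} [PartialOrder X] {f : X → X} {g : X ↪o X}

/-- The partial isomorphism `p` is compatible with finding an automorphism `t` extending it such
that `f ∘ t ∘ g = s`. -/
structure Compatible (f : X → X) (g : X ↪o X) (s : X → X) (p : Finset (X × X)) : Prop where
  isPartialIso : IsPartialIso p
  lt_of_lt : ∀ a ∈ p, ∀ x, a.1 < g x → f a.2 < s x
  lt_of_gt : ∀ a ∈ p, ∀ x, g x < a.1 → s x < f a.2
  eq_of_eq : ∀ a ∈ p, ∀ x, a.1 = g x → f a.2 = s x

open Classical in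
theorem Compatible.insert {s : X → X} {p : Finset (X × X)} (hp : Compatible f g s p) {x z : X}
    (h : IsPartialIso (insert (x, z) p)) (h1 : ∀ y, x < g y → f z < s y)
    (h2 : ∀ y, g y < x → s y < f z) (h3 : ∀ y, x = g y → f z = s y) :
    Compatible f g s (insert (x, z) p) := by
  refine ⟨h, fun a ha => ?_, fun a ha => ?_, fun a ha => ?_⟩ <;>
    rcases Finset.mem_insert.1 ha with rfl | ha
  · exact h1
  · exact hp.lt_of_lt a ha
  · exact h2
  · exact hp.lt_of_gt a ha
  · exact h3
  · exact hp.eq_of_eq a ha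

open IsPartialIso in
theorem Compatible.forth (hX : FiniteInterpolation X) (h : IsGenericPair f g) {s : X → X}
    (hs : StrictMono s) {p : Finset (X × X)} (hp : Compatible f g s p) (x : X) :
    ∃ q, p ⊆ q ∧ Compatible f g s q ∧ ∃ y, (x, y) ∈ q := by
  classical
  by_cases hx : ∃ y, (x, y) ∈ p
  · exact ⟨p, subset_rfl, hp, hx⟩
  have hx' : ∀ a ∈ p, a.1 ≠ x := by
    rintro ⟨a, b⟩ ha rfl
    exact hx ⟨b, ha⟩
  have hlt := hp.isPartialIso.right_lt_right x
  suffices ∃ q, (∀ l ∈ right p (· < x), f l < q) ∧ (∀ u ∈ right p (x < ·), q < f u) ∧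
      (∀ y, x < g y → q < s y) ∧ (∀ y, g y < x → s y < q) ∧ ∀ y, x = g y → q = s y by
    obtain ⟨q, hL, hU, h1, h2, h3⟩ := this
    obtain ⟨z, hz, -, rfl, hcut⟩ := h.realize (right p fun _ => True) _ _ q hlt hL hU
    exact ⟨_, Finset.subset_insert _ _, hp.insert (hp.isPartialIso.insert_of_right hx' hz
      fun d hd => hcut d (Or.inl hd)) h1 h2 h3, z, Finset.mem_insert_self _ _⟩
  by_cases hxg : ∃ b, x = g b
  · obtain ⟨b, rfl⟩ := hxg
    refine ⟨s b, fun l hl => ?_, fun u hu => ?_, fun y hy => hs (g.lt_iff_lt.1 hy),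
      fun y hy => hs (g.lt_iff_lt.1 hy), fun y hy => congrArg s (g.injective hy)⟩
    · obtain ⟨a, ha, hab, rfl⟩ := mem_right.1 hl
      exact hp.lt_of_lt a ha b hab
    · obtain ⟨a, ha, hab, rfl⟩ := mem_right.1 hu
      exact hp.lt_of_gt a ha b hab
  · obtain ⟨S, hS⟩ := h.upper x
    obtain ⟨T, hT⟩ := h.lower x
    have hne : ∀ y, x ≠ g y := fun y hy => hxg ⟨y, hy⟩
    obtain ⟨q, hq, hq'⟩ := hX
      ((right p (· < x)).image f ∪ (T.filter (g · ≤ x)).image s)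
      ((right p (x < ·)).image f ∪ (S.filter (x ≤ g ·)).image s) (by
        intro l hl u hu
        simp only [Finset.mem_union, Finset.mem_image, Finset.mem_filter, mem_right] at hl hu
        rcases hl with ⟨_, ⟨a, ha, hax, rfl⟩, rfl⟩ | ⟨b, ⟨-, hb⟩, rfl⟩ <;>
          rcases hu with ⟨_, ⟨c, hc, hcx, rfl⟩, rfl⟩ | ⟨d, ⟨-, hd⟩, rfl⟩
        · exact h.strictMono ((hp.isPartialIso.lt_iff ha hc).1 (hax.trans hcx))
        · exact hp.lt_of_lt a ha d (hax.trans_le hd)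
        · exact hp.lt_of_gt c hc b (lt_of_le_of_lt hb hcx)
        · exact hs (g.lt_iff_lt.1 (lt_of_le_of_lt hb (lt_of_le_of_ne hd (hne d)))))
    refine ⟨q, fun l hl => hq _ (Finset.mem_union_left _ (Finset.mem_image_of_mem _ hl)),
      fun u hu => hq' _ (Finset.mem_union_left _ (Finset.mem_image_of_mem _ hu)),
      fun y hy => ?_, fun y hy => ?_, fun y hy => (hne y hy).elim⟩
    · obtain ⟨c, hc, hxc, hcy⟩ := hS y hy.le
      exact (hq' _ (Finset.mem_union_right _ (Finset.mem_image_of_mem _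
        (Finset.mem_filter.2 ⟨hc, hxc⟩)))).trans_le (hs.monotone hcy)
    · obtain ⟨c, hc, hxc, hcy⟩ := hT y hy.le
      exact lt_of_le_of_lt (hs.monotone hcy) (hq _ (Finset.mem_union_right _
        (Finset.mem_image_of_mem _ (Finset.mem_filter.2 ⟨hc, hxc⟩))))

open IsPartialIso in
theorem Compatible.back (hX : FiniteInterpolation X) (h : IsGenericPair f g) {s : X → X}
    {p : Finset (X × X)} (hp : Compatible f g s p) (y : X) :
    ∃ q, p ⊆ q ∧ Compatible f g s q ∧ ∃ x, (x, y) ∈ q := by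
  classical
  by_cases hy : ∃ x, (x, y) ∈ p
  · exact ⟨p, subset_rfl, hp, hy⟩
  have hy' : ∀ a ∈ p, a.2 ≠ y := by
    rintro ⟨a, b⟩ ha rfl
    exact hy ⟨a, ha⟩
  have hlt := hp.isPartialIso.left_lt_left y
  obtain ⟨q, hL, hU⟩ := hX ((left p (· < y)).image f) ((left p (y < ·)).image f) (by
    simp only [Finset.forall_mem_image]
    exact fun l hl u hu => h.strictMono (hlt l hl u hu))
  simp only [Finset.forall_mem_image] at hL hU
  obtain ⟨z, hz, hzg, -, hcut⟩ := h.realize (left p fun _ => True) _ _ q hlt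
    (fun l hl => hL hl) (fun u hu => hU hu)
  refine ⟨_, Finset.subset_insert _ _, hp.insert (hp.isPartialIso.insert_of_left hy' hz
    fun d hd => hcut d (Or.inl hd)) (fun x hx => ?_) (fun x hx => ?_)
    (fun x hx => (hzg ⟨x, hx.symm⟩).elim), z, Finset.mem_insert_self _ _⟩
  · obtain ⟨u, hu, hux⟩ := (hcut _ (Or.inr ⟨x, rfl⟩)).2.1 hx
    obtain ⟨a, ha, hay, rfl⟩ := mem_left.1 hu
    refine (h.strictMono hay).trans_le ?_
    rcases hux.eq_or_lt with h' | h'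
    · exact (hp.eq_of_eq a ha x h').le
    · exact (hp.lt_of_lt a ha x h').le
  · obtain ⟨u, hu, hux⟩ := (hcut _ (Or.inr ⟨x, rfl⟩)).1.1 hx
    obtain ⟨a, ha, hay, rfl⟩ := mem_left.1 hu
    refine lt_of_le_of_lt ?_ (h.strictMono hay)
    rcases hux.eq_or_lt with h' | h'
    · exact (hp.eq_of_eq a ha x h'.symm).ge
    · exact (hp.lt_of_gt a ha x h').le

theorem Compatible.exists_orderIso [Countable X] (hX : FiniteInterpolation X)
    (h : IsGenericPair f g) {s : X → X} (hs : StrictMono s) {p : Finset (X × X)}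
    (hp : Compatible f g s p) :
    ∃ t : X ≃o X, (∀ a ∈ p, t a.1 = a.2) ∧ ∀ x, f (t (g x)) = s x := by
  obtain ⟨e, hep, he⟩ := exists_equiv_of_back_and_forth (Compatible f g s) p hp
    (fun q hq a ha b hb => hq.isPartialIso.eq_iff ha hb) (fun q hq => hq.forth hX h hs)
    (fun q hq => hq.back hX h)
  refine ⟨⟨e, fun {x x'} => ?_⟩, hep, fun x => ?_⟩
  · obtain ⟨q, hq, h, h'⟩ := he x x'
    exact (hq.isPartialIso _ h _ h').symm
  · obtain ⟨q, hq, h, -⟩ := he (g x) (g x)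
    exact hq.eq_of_eq _ h x rfl

theorem exists_orderIso [Countable X] (hX : FiniteInterpolation X) (h : IsGenericPair f g)
    {s : X → X} (hs : StrictMono s) : ∃ t : X ≃o X, ∀ x, f (t (g x)) = s x := by
  obtain ⟨t, -, ht⟩ := Compatible.exists_orderIso hX h hs (p := ∅)
    ⟨by simp [IsPartialIso], by simp, by simp, by simp⟩
  exact ⟨t, ht⟩

/-- The map `t ↦ f ∘ t ∘ g` is open. -/
theorem exists_orderIso_near [Countable X] (hX : FiniteInterpolation X) (h : IsGenericPair f g)
    (t : X ≃o X) (E : Finset X) : ∃ D : Finset X, ∀ s : X → X, StrictMono s →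
      (∀ x ∈ D, s x = f (t (g x))) →
        ∃ t' : X ≃o X, (∀ x ∈ E, t' x = t x) ∧ ∀ x, f (t' (g x)) = s x := by
  classical
  choose S hS using h.upper
  choose T hT using h.lower
  refine ⟨E.biUnion fun z => S z ∪ T z, fun s hs hsD => ?_⟩
  have hmono : ∀ z x, z < x → f (t z) < f (t x) := fun z x hzx => h.strictMono (t.strictMono hzx)
  obtain ⟨t', ht', hs'⟩ := Compatible.exists_orderIso hX h hs (p := E.image fun z => (z, t z)) (by
    constructor
    · simp [IsPartialIso]
    all_goals
      simp only [Finset.forall_mem_image]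
      intro z hz x hzx
    · obtain ⟨c, hc, hzc, hcx⟩ := hS z x hzx.le
      have hsc := hsD c (Finset.mem_biUnion.2 ⟨z, hz, Finset.mem_union_left _ hc⟩)
      rcases hzc.eq_or_lt with hzc | hzc
      · rw [hzc] at hzx ⊢
        rw [← hsc]
        exact hs (g.lt_iff_lt.1 hzx)
      · exact lt_of_lt_of_le (hsc ▸ hmono _ _ hzc) (hs.monotone hcx)
    · obtain ⟨c, hc, hzc, hcx⟩ := hT z x hzx.le
      have hsc := hsD c (Finset.mem_biUnion.2 ⟨z, hz, Finset.mem_union_right _ hc⟩)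
      rcases hzc.eq_or_lt with hzc | hzc
      · rw [← hzc] at hzx ⊢
        rw [← hsc]
        exact hs (g.lt_iff_lt.1 hzx)
      · exact lt_of_le_of_lt (hs.monotone hcx) (hsc ▸ hmono _ _ hzc)
    · obtain ⟨c, hc, hzc, hcx⟩ := hS z x hzx.le
      obtain ⟨d, hd, hzd, hxd⟩ := hT z x hzx.ge
      have hcx' : c = x := le_antisymm hcx (g.le_iff_le.1 (hzx ▸ hzc))
      rw [hzx, ← hcx']
      exact (hsD c (Finset.mem_biUnion.2 ⟨z, hz, Finset.mem_union_left _ hc⟩)).symm)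
  refine ⟨t', fun x hx => ?_, hs'⟩
  exact ht' (x, t x) (Finset.mem_image_of_mem _ hx)

end IsGenericPair

theorem OnePointExtension.of_homogeneous_of_universal {X : Type*} [PartialOrder X]
    (hhomog : OrderHomogeneous (fun x y : X => x < y))
    (huniv : OrderUniversal (fun x y : X => x < y)) : OnePointExtension X := by
  classical
  intro D L U hL hU hLU
  let r : Option D → Option D → Prop
    | some a, some b => a < b
    | some a, none => ∃ l ∈ L, a.1 ≤ l
    | none, some b => ∃ u ∈ U, u ≤ b.1
    | none, none => False
  have hirr : ∀ a, ¬ r a a := by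
    rintro (_ | a)
    · exact id
    · exact lt_irrefl a
  have htrans : ∀ a b c, r a b → r b c → r a c := by
    rintro (_ | a) (_ | b) (_ | c) hab hbc
    · exact hab
    · exact hab.elim
    · obtain ⟨u, hu, hub⟩ := hab
      obtain ⟨l, hl, hbl⟩ := hbc
      exact (hLU l hl u hu).not_ge (hub.trans hbl)
    · obtain ⟨u, hu, hub⟩ := hab
      have hbc' : b.1 < c.1 := hbc
      exact ⟨u, hu, hub.trans hbc'.le⟩
    · exact hbc.elim
    · obtain ⟨l, hl, hal⟩ := hab
      obtain ⟨u, hu, huc⟩ := hbc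
      have hac : a.1 < c.1 := hal.trans_lt ((hLU l hl u hu).trans_le huc)
      exact hac
    · obtain ⟨l, hl, hbl⟩ := hbc
      have hab' : a.1 < b.1 := hab
      exact ⟨l, hl, hab'.le.trans hbl⟩
    · exact lt_trans hab hbc
  let φ := Fintype.equivFin (Option D)
  obtain ⟨e, he, her⟩ := huniv _ (fun i j => r (φ.symm i) (φ.symm j)) (fun i => hirr _)
    (fun i j k => htrans _ _ _)
  have her' : ∀ a b, r a b ↔ e (φ a) < e (φ b) := fun a b => by
    simpa using her (φ a) (φ b)
  let p : X → X := fun x => if hx : x ∈ D then e (φ (some ⟨x, hx⟩)) else x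
  have hp : ∀ x (hx : x ∈ D), p x = e (φ (some ⟨x, hx⟩)) := fun x hx => dif_pos hx
  obtain ⟨G, ⟨hGinj, hGsurj⟩, hGlt, hGD⟩ := hhomog D p
    (fun x hx y hy hxy => by
      rw [hp x hx, hp y hy] at hxy
      simpa using φ.injective.eq_iff.1 (he hxy))
    (fun x hx y hy => by
      change x < y ↔ p x < p y
      rw [hp x hx, hp y hy, ← her']
      exact Iff.rfl)
  have hGlt' : ∀ x y : X, x < y ↔ G x < G y := hGlt
  obtain ⟨z, hz⟩ := hGsurj (e (φ none))
  refine ⟨z, fun hzD => ?_, fun d hd => ⟨?_, ?_⟩⟩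
  · rw [hGD z hzD, hp z hzD] at hz
    simpa using he hz
  · rw [hGlt', hz, hGD d hd, hp d hd, ← her']
  · rw [hGlt', hz, hGD d hd, hp d hd, ← her']

theorem OnePointExtension.exists_separating {X : Type*} [PartialOrder X] [Countable X]
    (hX : OnePointExtension X) (a : X) :
    ∃ α β : X → X, StrictMono α ∧ StrictMono β ∧ ∀ x, α x = β x ↔ x ≠ a := by
  classical
  let r : X × Bool → X × Bool → Prop := fun p q => p.1 < q.1
  have : IsStrictOrder (X × Bool) r :=
    { irrefl := fun p => lt_irrefl p.1
      trans := fun p q s => lt_trans }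
  obtain ⟨g, -⟩ := @exists_generic_orderIso X (X × Bool) X _ _ hX (partialOrderOfSO r) _ _ _
    hX.finiteInterpolation Prod.fst (fun _ _ h => h)
  refine ⟨fun x => g (x, false), fun x => g (x, decide (x = a)), fun x y h => ?_, fun x y h => ?_,
    fun x => ?_⟩
  · exact (@OrderEmbedding.lt_iff_lt _ _ (partialOrderOfSO r).toPreorder _ g _ _).2 h
  · exact (@OrderEmbedding.lt_iff_lt _ _ (partialOrderOfSO r).toPreorder _ g _ _).2 h
  · rw [g.injective.eq_iff]
    simp

theorem exists_strictMono_rat (X : Type*) [PartialOrder X] [Countable X] :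
    ∃ f : X → ℚ, StrictMono f := by
  have : Countable (LinearExtension X) := inferInstanceAs (Countable X)
  obtain ⟨e⟩ := Order.embedding_from_countable_to_dense (LinearExtension X) ℚ
  have hinj : Function.Injective (toLinearExtension : X →o LinearExtension X) := fun _ _ h => h
  exact ⟨e ∘ toLinearExtension,
    e.strictMono.comp (toLinearExtension.monotone.strictMono_of_injective hinj)⟩

/-- There are two endomorphisms whose images lie in a common chain and meet in `x` only. -/
theorem OnePointExtension.exists_chains {X : Type*} [PartialOrder X] [Countable X]
    (hX : OnePointExtension X) (hhomog : OrderHomogeneous (fun x y : X => x < y)) (x : X) :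
    ∃ γ δ : X → X, StrictMono γ ∧ StrictMono δ ∧ (∃ u, γ u = x) ∧ (∃ v, δ v = x) ∧
      ∀ u v, γ u = x ∧ δ v = x ∨ γ u < δ v ∨ δ v < γ u := by
  classical
  obtain ⟨f, hf⟩ := exists_strictMono_rat X
  have : Countable (ℚ ×ₗ Fin 2) := inferInstanceAs (Countable (ℚ × Fin 2))
  obtain ⟨c⟩ := Order.embedding_from_countable_to_dense (ℚ ×ₗ Fin 2) ℚ
  obtain ⟨k, -⟩ := exists_generic_orderIso hX finiteInterpolation_rat c c.strictMono
  obtain ⟨ρ, -, hρ, hρx⟩ := hhomog {k (toLex (0, 0))} (fun _ => x)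
    (by simp) (by simp)
  have hρx : ρ (k (toLex (0, 0))) = x := hρx _ (by simp)
  have hρ' : StrictMono ρ := fun a b h => (hρ a b).1 h
  have hk := hρ'.comp k.strictMono
  refine ⟨fun u => ρ (k (toLex (f u - f x, 0))),
    fun u => ρ (k (toLex (f u - f x, if f u - f x = 0 then 0 else 1))), fun u v h => hk ?_,
    fun u v h => hk ?_, ⟨x, by simpa using hρx⟩, ⟨x, by simpa using hρx⟩, fun u v => ?_⟩
  · exact Prod.Lex.toLex_lt_toLex.2 (Or.inl (sub_lt_sub_right (hf h) _))
  · exact Prod.Lex.toLex_lt_toLex.2 (Or.inl (sub_lt_sub_right (hf h) _))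
  · rcases lt_trichotomy (toLex (f u - f x, (0 : Fin 2)))
      (toLex (f v - f x, if f v - f x = 0 then 0 else 1)) with h | h | h
    · exact Or.inr (Or.inl (hk h))
    · left
      have h' := toLex.injective h
      rw [Prod.mk.injEq] at h'
      have h0 : f v - f x = 0 := by
        by_contra h0
        simp [h0] at h'
      have h0' : f u - f x = 0 := h'.1.trans h0
      simp only [h0, h0', if_true]
      exact ⟨hρx, hρx⟩
    · exact Or.inr (Or.inr (hk h))

open Filter Topology

/-- A Baire measurable map to a second countable space is sequentially continuous on a residual
set. -/
theorem exists_residual_tendsto {A Y : Type*} [TopologicalSpace A] [TopologicalSpace Y]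
    [SecondCountableTopology Y] (φ : A → Y)
    (hφ : ∀ U, IsOpen U → BaireMeasurableSet (φ ⁻¹' U)) :
    ∃ C ∈ residual A, ∀ a ∈ C, ∀ u : ℕ → A, (∀ n, u n ∈ C) → Tendsto u atTop (𝓝 a) →
      Tendsto (fun n => φ (u n)) atTop (𝓝 (φ a)) := by
  have hB := TopologicalSpace.isBasis_countableBasis Y
  have hex : ∀ U ∈ TopologicalSpace.countableBasis Y,
      ∃ O : Set A, IsOpen O ∧ φ ⁻¹' U =ᶠ[residual A] O := fun U hU =>
    (hφ U (hB.isOpen hU)).residualEq_isOpen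
  choose! O hO hUO using hex
  refine ⟨⋂ U ∈ TopologicalSpace.countableBasis Y, {a | a ∈ φ ⁻¹' U ↔ a ∈ O U}, ?_, ?_⟩
  · refine (countable_bInter_mem (TopologicalSpace.countable_countableBasis Y)).2 fun U hU => ?_
    filter_upwards [hUO U hU] with a ha
    exact iff_of_eq ha
  · intro a ha u hu hua
    simp only [Set.mem_iInter, Set.mem_ofPred_eq] at ha hu
    refine (hB.nhds_hasBasis.tendsto_right_iff).2 fun U ⟨hU, haU⟩ => ?_
    filter_upwards [hua ((hO U hU).mem_nhds ((ha U hU).1 haU))] with n hn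
    exact (hu n U hU).2 hn

theorem baireMeasurableSet_preimage_of_le {A Y : Type*} [TopologicalSpace A]
    {τ σ : TopologicalSpace Y} (hτ : @PolishSpace Y τ) (hσ : @PolishSpace Y σ) (hle : τ ≤ σ)
    {φ : A → Y} (hφ : @Continuous A Y _ σ φ) {U : Set Y} (hU : IsOpen[τ] U) :
    BaireMeasurableSet (φ ⁻¹' U) := by
  have hU' : @MeasurableSet Y (@borel Y σ) U := by
    rw [← MeasureTheory.borel_eq_borel_of_le hτ hσ hle]
    exact MeasurableSpace.measurableSet_generateFrom hU
  borelize A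
  exact ((@Continuous.borel_measurable A Y _ σ φ hφ) hU').baireMeasurableSet

theorem continuous_apply_of_discrete {Y X Z : Type*} [TopologicalSpace Y] [TopologicalSpace X]
    [DiscreteTopology X] [TopologicalSpace Z] {u : Y → X → Z} {v : Y → X} (hu : Continuous u)
    (hv : Continuous v) : Continuous fun y => u y (v y) := by
  rw [continuous_iff_continuousAt]
  intro y₀
  have h1 : ContinuousAt (fun y => u y (v y₀)) y₀ :=
    ((continuous_apply (v y₀)).comp hu).continuousAt
  refine h1.congr ?_
  filter_upwards [hv.continuousAt.preimage_mem_nhds (IsOpen.mem_nhds (isOpen_discrete {v y₀}) rfl)]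
    with y hy
  rw [show v y = v y₀ from hy]

theorem exists_finset_of_mem_nhds_pi {X Y : Type*} [TopologicalSpace Y] {u : X → Y}
    {V : Set (X → Y)} (hV : V ∈ 𝓝 u) :
    ∃ E : Finset X, ∀ v : X → Y, (∀ x ∈ E, v x = u x) → v ∈ V := by
  obtain ⟨W, hWV, hW, huW⟩ := mem_nhds_iff.1 hV
  obtain ⟨E, O, hO, hE⟩ := isOpen_pi_iff.1 hW u huW
  exact ⟨E, fun v hv => hWV (hE fun x hx => hv x hx ▸ (hO x hx).2)⟩

section Pointwise

variable {X : Type*} [TopologicalSpace X] [DiscreteTopology X]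

theorem pointwiseTop_eq_induced (S : Set (X → X)) :
    pointwiseTop X S = TopologicalSpace.induced Subtype.val Pi.topologicalSpace := by
  refine le_antisymm ?_ ?_
  · let := pointwiseTop X S
    rw [← continuous_iff_le_induced]
    refine continuous_pi fun x => continuous_discrete_rng.2 fun y => ?_
    exact TopologicalSpace.isOpen_generateFrom_of_mem ⟨x, y, rfl⟩
  · refine le_generateFrom ?_
    rintro _ ⟨x, y, rfl⟩
    have hx : Continuous fun f : X → X => f x := continuous_apply x
    exact isOpen_induced ((isOpen_discrete {y}).preimage hx)

theorem isPolishSemigroupTop_pointwiseTop [Countable X] [PartialOrder X] :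
    IsPolishSemigroupTop (orderEnd_comp fun x y : X => x < y)
      (pointwiseTop X (orderEnd fun x y : X => x < y)) := by
  have : PolishSpace X := {}
  rw [pointwiseTop_eq_induced]
  constructor
  · refine IsClosed.polishSpace ?_
    simp only [orderEnd, Set.ofPred_forall]
    refine isClosed_iInter fun x => isClosed_iInter fun y => isClosed_iInter fun _ => ?_
    have hxy : Continuous fun f : X → X => (f x, f y) :=
      (continuous_apply x).prodMk (continuous_apply y)
    exact (isClosed_discrete {p : X × X | p.1 < p.2}).preimage hxy
  · refine Continuous.subtype_mk (continuous_pi fun x => ?_) _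
    have hx : Continuous fun f : X → X => f x := continuous_apply x
    exact continuous_apply_of_discrete
      (u := fun p : ↥(orderEnd fun x y : X => x < y) × ↥(orderEnd fun x y : X => x < y) => p.2.1)
      (v := fun p => p.1.1 x) (continuous_subtype_val.comp continuous_snd)
      (hx.comp (continuous_subtype_val.comp continuous_fst))

end Pointwise

/-- The product of two endomorphisms, composed in diagrammatic order. -/
def endMul {X : Type*} [PartialOrder X] (p q : ↥(orderEnd fun x y : X => x < y)) :
    ↥(orderEnd fun x y : X => x < y) :=
  ⟨q.1 ∘ p.1, orderEnd_comp _ p.1 p.2 q.1 q.2⟩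

namespace OrderIso

variable {X : Type*} [PartialOrder X]

/-- An automorphism together with its inverse. -/
def pair (t : X ≃o X) : (X → X) × (X → X) := (t, t.symm)

theorem pair_injective : Function.Injective (pair : (X ≃o X) → (X → X) × (X → X)) :=
  fun _ _ h => DFunLike.coe_injective (congrArg Prod.fst h)

/-- An automorphism as an element of the endomorphism monoid. -/
def toEnd (t : X ≃o X) : ↥(orderEnd fun x y : X => x < y) := ⟨t, fun _ _ h => t.strictMono h⟩

theorem endMul_toEnd_symm_toEnd_trans (w s : X ≃o X) :
    endMul (toEnd w.symm) (toEnd (w.trans s)) = toEnd s := by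
  ext x
  simp [toEnd, endMul]

variable [TopologicalSpace X]

/-- The topology of pointwise convergence of automorphisms and their inverses. -/
local instance : TopologicalSpace (X ≃o X) := TopologicalSpace.induced pair inferInstance

theorem continuous_pair : Continuous (pair : (X ≃o X) → (X → X) × (X → X)) :=
  continuous_induced_dom

theorem exists_finset_of_mem_nhds {t : X ≃o X} {V : Set (X ≃o X)} (hV : V ∈ 𝓝 t) :
    ∃ E : Finset X, ∀ t' : X ≃o X, (∀ x ∈ E, t' x = t x) → t' ∈ V := by
  classical
  rw [nhds_induced, mem_comap] at hV
  obtain ⟨W, hW, hWV⟩ := hV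
  obtain ⟨W₁, hW₁, W₂, hW₂, hWW⟩ := mem_nhds_prod_iff.1 hW
  obtain ⟨E₁, hE₁⟩ := exists_finset_of_mem_nhds_pi hW₁
  obtain ⟨E₂, hE₂⟩ := exists_finset_of_mem_nhds_pi hW₂
  refine ⟨E₁ ∪ E₂.image t.symm, fun t' ht' => hWV (hWW ⟨hE₁ _ fun x hx => ?_,
    hE₂ _ fun x hx => ?_⟩)⟩
  · exact ht' x (Finset.mem_union_left _ hx)
  · have := ht' (t.symm x) (Finset.mem_union_right _ (Finset.mem_image_of_mem _ hx))
    rw [t.apply_symm_apply] at this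
    change t'.symm x = t.symm x
    rw [← this, t'.symm_apply_apply, this]

variable [DiscreteTopology X]

theorem isClosedEmbedding_pair :
    IsClosedEmbedding (pair : (X ≃o X) → (X → X) × (X → X)) := by
  refine ⟨⟨⟨rfl⟩, pair_injective⟩, ?_⟩
  have : Set.range (pair : (X ≃o X) → (X → X) × (X → X)) =
      {p | ∀ x, p.1 (p.2 x) = x} ∩ {p | ∀ x, p.2 (p.1 x) = x} ∩
        {p | ∀ x y, p.1 x ≤ p.1 y ↔ x ≤ y} := by
    ext p
    constructor
    · rintro ⟨t, rfl⟩
      exact ⟨⟨t.apply_symm_apply, t.symm_apply_apply⟩, fun x y => t.le_iff_le⟩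
    · rintro ⟨⟨h1, h2⟩, h3⟩
      exact ⟨⟨⟨p.1, p.2, h2, h1⟩, fun {x y} => h3 x y⟩, rfl⟩
  rw [this]
  simp only [Set.ofPred_forall]
  refine ((isClosed_iInter fun x => ?_).inter (isClosed_iInter fun x => ?_)).inter
    (isClosed_iInter fun x => isClosed_iInter fun y => ?_)
  · exact isClosed_eq (continuous_apply_of_discrete continuous_fst
      ((continuous_apply x).comp continuous_snd)) continuous_const
  · exact isClosed_eq (continuous_apply_of_discrete continuous_snd
      ((continuous_apply x).comp continuous_fst)) continuous_const
  · have hxy : Continuous fun p : (X → X) × (X → X) => (p.1 x, p.1 y) := by fun_prop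
    exact (isClosed_discrete {q : X × X | q.1 ≤ q.2 ↔ x ≤ y}).preimage hxy

theorem polishSpace [Countable X] : PolishSpace (X ≃o X) := by
  have : PolishSpace X := {}
  exact isClosedEmbedding_pair.polishSpace

theorem continuous_trans_left (w : X ≃o X) : Continuous fun t : X ≃o X => w.trans t := by
  refine continuous_induced_rng.2 (Continuous.prodMk ?_ ?_)
  · exact continuous_pi fun x => (continuous_apply (w x)).comp (continuous_fst.comp continuous_pair)
  · exact continuous_pi fun x => (continuous_of_discreteTopology (f := w.symm)).comp
      ((continuous_apply x).comp (continuous_snd.comp continuous_pair))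

theorem continuous_trans_right (w : X ≃o X) : Continuous fun t : X ≃o X => t.trans w := by
  refine continuous_induced_rng.2 (Continuous.prodMk ?_ ?_)
  · exact continuous_pi fun x => (continuous_of_discreteTopology (f := w)).comp
      ((continuous_apply x).comp (continuous_fst.comp continuous_pair))
  · exact continuous_pi fun x =>
      (continuous_apply (w.symm x)).comp (continuous_snd.comp continuous_pair)

theorem continuous_toEnd_pointwiseTop :
    @Continuous (X ≃o X) _ _ (pointwiseTop X (orderEnd fun x y : X => x < y)) toEnd := by
  rw [pointwiseTop_eq_induced]
  exact continuous_induced_rng.2 (continuous_fst.comp continuous_pair)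

/-- Composition with a fixed automorphism on the right, as a homeomorphism. -/
def transRight (s : X ≃o X) : (X ≃o X) ≃ₜ (X ≃o X) where
  toFun w := w.trans s
  invFun w := w.trans s.symm
  left_inv w := by ext; simp
  right_inv w := by ext; simp
  continuous_toFun := continuous_trans_right s
  continuous_invFun := continuous_trans_right s.symm

theorem continuous_toEnd [Countable X] (τ : TopologicalSpace ↥(orderEnd fun x y : X => x < y))
    (hτ : IsPolishSemigroupTop (orderEnd_comp fun x y : X => x < y) τ)
    (hle : τ ≤ pointwiseTop X (orderEnd fun x y : X => x < y)) :
    @Continuous (X ≃o X) _ _ τ toEnd := by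
  have := polishSpace (X := X)
  have hpol := hτ.1
  obtain ⟨C, hC, hCt⟩ := exists_residual_tendsto (toEnd : (X ≃o X) → _) fun U hU =>
    baireMeasurableSet_preimage_of_le hpol isPolishSemigroupTop_pointwiseTop.1 hle
      continuous_toEnd_pointwiseTop hU
  refine SeqContinuous.continuous fun u t hut => ?_
  have hmem : ∀ s : X ≃o X, {w : X ≃o X | w.trans s ∈ C} ∈ residual (X ≃o X) := fun s =>
    tendsto_residual_of_isOpenMap (transRight s).continuous (transRight s).isOpenMap hC
  have : Nonempty (X ≃o X) := ⟨OrderIso.refl X⟩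
  obtain ⟨w, hw, hwu⟩ := (dense_of_mem_residual
    (inter_mem (hmem t) (countable_iInter_mem.2 fun n => hmem (u n)))).nonempty
  have hlim := hCt _ hw _ (fun n => Set.mem_iInter.1 hwu n)
    (((continuous_trans_left w).tendsto t).comp hut)
  have hcomp : Tendsto (fun n => endMul (toEnd w.symm) (toEnd (w.trans (u n)))) atTop
      (𝓝 (endMul (toEnd w.symm) (toEnd (w.trans t)))) :=
    (hτ.2.tendsto (toEnd w.symm, toEnd (w.trans t))).comp (tendsto_const_nhds.prodMk_nhds hlim)
  simp only [endMul_toEnd_symm_toEnd_trans] at hcomp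
  exact hcomp

end OrderIso

theorem OnePointExtension.le_pointwiseTop {X : Type*} [PartialOrder X] [Countable X]
    (hX : OnePointExtension X) (hhomog : OrderHomogeneous (fun x y : X => x < y))
    (τ : TopologicalSpace ↥(orderEnd fun x y : X => x < y))
    (hτ : IsPolishSemigroupTop (orderEnd_comp fun x y : X => x < y) τ) :
    τ ≤ pointwiseTop X (orderEnd fun x y : X => x < y) := by
  have hpol := hτ.1
  refine le_generateFrom ?_
  rintro _ ⟨x, y, rfl⟩
  obtain ⟨γ, δ, hγ, hδ, ⟨u₀, hu₀⟩, ⟨v₀, hv₀⟩, hγδ⟩ := hX.exists_chains hhomog x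
  obtain ⟨α, β, hα, hβ, hαβ⟩ := hX.exists_separating y
  let mk : ∀ s : X → X, StrictMono s → ↥(orderEnd fun x y : X => x < y) :=
    fun s hs => ⟨s, fun _ _ h => hs h⟩
  have hmul : Continuous fun p : ↥(orderEnd fun x y : X => x < y) ×
    ↥(orderEnd fun x y : X => x < y) => endMul p.1 p.2 := hτ.2
  have hconj : ∀ p q, Continuous fun f => endMul (endMul p f) q := fun p q =>
    hmul.comp ((hmul.comp (continuous_const.prodMk continuous_id)).prodMk continuous_const)
  have hopen : ∀ s hs, IsOpen {f | endMul (endMul (mk s hs) f) (mk α hα) ≠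
      endMul (endMul (mk s hs) f) (mk β hβ)} := fun s hs =>
    isOpen_ne_fun (hconj _ _) (hconj _ _)
  have hiff : ∀ (s hs) (f : ↥(orderEnd fun x y : X => x < y)),
      endMul (endMul (mk s hs) f) (mk α hα) ≠ endMul (endMul (mk s hs) f) (mk β hβ) ↔
        ∃ u, f.1 (s u) = y := by
    intro s hs f
    rw [ne_eq, Subtype.ext_iff, funext_iff, not_forall]
    refine exists_congr fun u => ?_
    change ¬ α (f.1 (s u)) = β (f.1 (s u)) ↔ _
    rw [hαβ, not_not]
  convert (hopen γ hγ).inter (hopen δ hδ) using 1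
  ext f
  change f.1 x = y ↔ _ ∧ _
  refine Iff.trans ?_ (and_congr (hiff γ hγ f) (hiff δ hδ f)).symm
  constructor
  · exact fun h => ⟨⟨u₀, hu₀ ▸ h⟩, ⟨v₀, hv₀ ▸ h⟩⟩
  · rintro ⟨⟨u, hu⟩, ⟨v, hv⟩⟩
    rcases hγδ u v with h | h | h
    · exact h.1 ▸ hu
    · exact absurd (f.2 _ _ h) (by simp [hu, hv])
    · exact absurd (f.2 _ _ h) (by simp [hu, hv])

theorem OnePointExtension.isPolishSemigroupTop_iff {X : Type*} [PartialOrder X] [Countable X]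
    (hX : OnePointExtension X) (hhomog : OrderHomogeneous (fun x y : X => x < y))
    (τ : TopologicalSpace ↥(orderEnd fun x y : X => x < y)) :
    IsPolishSemigroupTop (orderEnd_comp fun x y : X => x < y) τ ↔
      τ = pointwiseTop X (orderEnd fun x y : X => x < y) := by
  let : TopologicalSpace X := ⊥
  have : DiscreteTopology X := ⟨rfl⟩
  let : TopologicalSpace (X ≃o X) := TopologicalSpace.induced OrderIso.pair inferInstance
  refine ⟨fun hτ => ?_, fun h => h ▸ isPolishSemigroupTop_pointwiseTop⟩
  have hle := hX.le_pointwiseTop hhomog τ hτ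
  refine le_antisymm hle (le_of_nhds_le_nhds fun s U hU => ?_)
  have hs : StrictMono s.1 := fun x y h => s.2 x y h
  obtain ⟨f, g, hfg⟩ := hX.exists_isGenericPair
  obtain ⟨t, ht⟩ := hfg.exists_orderIso hX.finiteInterpolation hs
  let f' : ↥(orderEnd fun x y : X => x < y) := ⟨f, fun _ _ h => hfg.strictMono h⟩
  let g' : ↥(orderEnd fun x y : X => x < y) := ⟨g, fun _ _ h => g.strictMono h⟩
  let Ψ : (X ≃o X) → ↥(orderEnd fun x y : X => x < y) := fun t => endMul (endMul g' t.toEnd) f'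
  have hΨ : Continuous Ψ := hτ.2.comp ((hτ.2.comp ((continuous_const (y := g')).prodMk
    (OrderIso.continuous_toEnd τ hτ hle))).prodMk (continuous_const (y := f')))
  have hΨ_eq : ∀ (t' : X ≃o X) (s' : ↥(orderEnd fun x y : X => x < y)),
      (∀ x, f (t' (g x)) = s'.1 x) → Ψ t' = s' := fun t' s' h => Subtype.ext (funext h)
  have hUt : U ∈ 𝓝 (Ψ t) := (hΨ_eq t s ht).symm ▸ hU
  obtain ⟨E, hE⟩ := OrderIso.exists_finset_of_mem_nhds (hΨ.continuousAt.preimage_mem_nhds hUt)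
  obtain ⟨D, hD⟩ := hfg.exists_orderIso_near hX.finiteInterpolation t E
  have hnhds : (⋂ x ∈ D, {s' : ↥(orderEnd fun x y : X => x < y) | s'.1 x = s.1 x}) ∈
      @nhds _ (pointwiseTop X (orderEnd fun x y : X => x < y)) s := by
    refine (biInter_finset_mem D).2 fun x _ => ?_
    exact @IsOpen.mem_nhds _ (pointwiseTop X _) _ _
      (TopologicalSpace.isOpen_generateFrom_of_mem ⟨x, s.1 x, rfl⟩) rfl
  refine mem_of_superset hnhds fun s' hs' => ?_
  simp only [Set.mem_iInter] at hs'
  obtain ⟨t', htt', ht'⟩ := hD s'.1 (fun x y h => s'.2 x y h)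
    fun x hx => (hs' x hx).trans (ht x).symm
  exact hΨ_eq t' s' ht' ▸ hE t' htt'

theorem randomPoset_unique_polish_semigroup_topology
    [Countable P] (lt : P → P → Prop)
    (hirr : Irreflexive lt) (htrans : Transitive lt)
    (hhomog : OrderHomogeneous lt) (huniv : OrderUniversal lt) :
    IsPolishSemigroupTop (orderEnd_comp lt) (pointwiseTop P (orderEnd lt)) ∧
      ∀ τ : TopologicalSpace ↥(orderEnd lt),
        IsPolishSemigroupTop (orderEnd_comp lt) τ →
        τ = pointwiseTop P (orderEnd lt) := by
  have : IsStrictOrder P lt := { irrefl := hirr, trans := fun _ _ _ h₁ h₂ => htrans h₁ h₂ }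
  let : PartialOrder P := partialOrderOfSO lt
  have hX := OnePointExtension.of_homogeneous_of_universal (X := P) hhomog huniv
  exact ⟨(hX.isPolishSemigroupTop_iff hhomog _).2 rfl,
    fun τ => (hX.isPolishSemigroupTop_iff hhomog τ).1⟩
end
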